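/- Let n ≥ 3 and let φ, f, S, X_0, X_m and Φ_0^m be as described in the context. Let m ≥ 2, let ñ be an integer with 1 ≤ ñ ≤ n−1, let T be a simple-ñ-od graph with branch point s_0, and suppose α : X_m → T and β : T → X_0 are simplicial maps such that α is surjective, β ∘ α = Φ_0^m, and β(s_0) = v_0. Then there exist an integer ñ_1 with 1 ≤ ñ_1 ≤ ñ, a simple-ñ_1-od graph T̂ whose arms are vertex paths ⟨ŝ_0, ŝ_1^i, …, ŝ_{k̂_i}^i⟩ (1 ≤ i ≤ ñ_1) with common branch point ŝ_0, and simplicial maps α̂ : X_m → T̂ and β̂ : T̂ → X_0 such that β̂ ∘ α̂ = Φ_0^m, β̂(ŝ_0) = v_0, and β̂(ŝ_1^δ) = v_{n−1} for every δ with 1 ≤ δ ≤ ñ_1 (that is, β̂ maps every edge of T̂ at the branch point onto the edge ⟨v_0, v_{n−1}⟩ of X_0). -/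

import Mathlib

/-! ## Graphs (geometric realizations of finite connected 1-complexes) -/

/-- The data of a graph structure on a space `G`: a finite vertex set and
finitely many parametrized edges. -/
structure GraphData (G : Type*) where
  verts : Finset G
  nE : ℕ
  edge : Fin nE → ℝ → G

namespace GraphData

variable {G : Type*}

/-- Two vertices are adjacent if they are joined by an edge. -/
def Adj (Γ : GraphData G) (v w : G) : Prop :=
  ∃ e, ({Γ.edge e 0, Γ.edge e 1} : Set G) = {v, w}

/-- The axioms making `Γ` an actual graph (a finite connected one-dimensional
simplicial complex realized in `G`): each edge is an arc (parametrized by `[0,1]`)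
joining two distinct vertices, open edges avoid the vertices, the edges cover `G`,
two distinct edges meet only in vertices, and an edge is determined by its
endpoints. -/
def IsGraph [TopologicalSpace G] (Γ : GraphData G) : Prop :=
  (∀ e, ContinuousOn (Γ.edge e) (Set.Icc 0 1)) ∧
  (∀ e, Set.InjOn (Γ.edge e) (Set.Icc 0 1)) ∧
  (∀ e, Γ.edge e 0 ∈ Γ.verts) ∧
  (∀ e, Γ.edge e 1 ∈ Γ.verts) ∧
  (∀ e, Γ.edge e 0 ≠ Γ.edge e 1) ∧
  (∀ e, ∀ t ∈ Set.Ioo (0:ℝ) 1, Γ.edge e t ∉ (Γ.verts : Set G)) ∧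
  (⋃ e, Γ.edge e '' Set.Icc 0 1) = Set.univ ∧
  (∀ e e', e ≠ e' →
    (Γ.edge e '' Set.Icc 0 1) ∩ (Γ.edge e' '' Set.Icc 0 1) ⊆ (Γ.verts : Set G)) ∧
  (∀ e e', ({Γ.edge e 0, Γ.edge e 1} : Set G) = {Γ.edge e' 0, Γ.edge e' 1} → e = e')

end GraphData

/-- A simplicial map between graphs: continuous, vertices to vertices, and each
edge is mapped either onto a vertex or, affinely with respect to the fixed
parametrizations, onto an edge. -/
def IsSimplicialMap {G H : Type*} [TopologicalSpace G] [TopologicalSpace H]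
    (Γ : GraphData G) (Δ : GraphData H) (φ : G → H) : Prop :=
  Continuous φ ∧ (∀ v ∈ Γ.verts, φ v ∈ Δ.verts) ∧
  ∀ e, (∃ w ∈ Δ.verts, ∀ t ∈ Set.Icc (0:ℝ) 1, φ (Γ.edge e t) = w) ∨
    ∃ e', (∀ t ∈ Set.Icc (0:ℝ) 1, φ (Γ.edge e t) = Δ.edge e' t) ∨
          (∀ t ∈ Set.Icc (0:ℝ) 1, φ (Γ.edge e t) = Δ.edge e' (1 - t))

/-- `Γ` is a simple-`m`-od graph with branch point `t₀` and arms given by the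
vertex paths `⟨t₀, t i 1, …, t i (k i)⟩` (`i < m`): the arms are nondegenerate,
pairwise meet exactly in `t₀`, exhaust the vertices, and two vertices are
adjacent exactly when they are consecutive on an arm. -/
def IsSimpleOdWith {G : Type*} [TopologicalSpace G] (Γ : GraphData G) (m : ℕ) (t₀ : G)
    (k : Fin m → ℕ) (t : Fin m → ℕ → G) : Prop :=
  Γ.IsGraph ∧ (∀ i, 1 ≤ k i) ∧ (∀ i, t i 0 = t₀) ∧
  ((Γ.verts : Set G) = {t₀} ∪ {x | ∃ i j, 1 ≤ j ∧ j ≤ k i ∧ x = t i j}) ∧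
  (∀ i j i' j', 1 ≤ j → j ≤ k i → 1 ≤ j' → j' ≤ k i' → t i j = t i' j' →
    i = i' ∧ j = j') ∧
  (∀ i j, 1 ≤ j → j ≤ k i → t i j ≠ t₀) ∧
  (∀ v w, Γ.Adj v w ↔ ∃ i j, j + 1 ≤ k i ∧ ({v, w} : Set G) = {t i j, t i (j + 1)})

/-- `Γ` is a simple-`m`-od graph with branch point `t₀`. -/
def IsSimpleOdGraphData {G : Type*} [TopologicalSpace G] (Γ : GraphData G) (m : ℕ)
    (t₀ : G) : Prop :=
  ∃ k t, IsSimpleOdWith Γ m t₀ k t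

/-- Composite bonding maps `Φ_i^{i+k} : X (i+k) → X i` of an inverse sequence. -/
def bondIter {X : ℕ → Type*} (Φ : ∀ i, X (i + 1) → X i) (i : ℕ) :
    ∀ k : ℕ, X (i + k) → X i
  | 0 => id
  | k + 1 => fun x => bondIter Φ i k (Φ (i + k) x)

/-- The inverse limit of an inverse sequence of spaces. -/
def InvLimit {X : ℕ → Type*} (Φ : ∀ i, X (i + 1) → X i) : Type _ :=
  {x : ∀ i, X i // ∀ i, Φ i (x (i + 1)) = x i}

instance {X : ℕ → Type*} [∀ i, TopologicalSpace (X i)] (Φ : ∀ i, X (i + 1) → X i) :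
    TopologicalSpace (InvLimit Φ) :=
  instTopologicalSpaceSubtype
/-! ## The simple-`n`-od `S`, the bonding map `φ = nφ`, and the continuum `nK` -/

noncomputable section

/-- Arm-coordinate parametrization of the simple-`n`-od in `ℂ`: the pair `(k, t)`
is sent to the point at (clamped) parameter `t ∈ [0,1]` on the ray in the
direction `e^{2πik/n}`. -/
def embC (n : ℕ) (p : ℕ × ℝ) : ℂ :=
  ((min 1 (max 0 p.2) : ℝ) : ℂ) * Complex.exp (2 * Real.pi * Complex.I * (p.1 : ℂ) / (n : ℂ))

/-- The underlying simple-`n`-od `S ⊆ ℂ`. -/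
def Sset (n : ℕ) : Set ℂ := Set.range (embC n)

/-- The simple-`n`-od `S` as a (compact metric) space. -/
abbrev Sspace (n : ℕ) := ↥(Sset n)

/-- Arm coordinates `(ray index, parameter)` of the vertices `v_0, …, v_{n+2}`
of the graph `X_0`:  `v_0` is the branch point; for `1 ≤ i ≤ n-2`, `v_i` is the tip
of ray `i - 1`; `v_{n-1}` and `v_{n+1}` are the midpoint and tip of ray `n - 2`;
`v_n` and `v_{n+2}` are the midpoint and tip of ray `n - 1`. -/
def vcoord (n i : ℕ) : ℕ × ℝ :=
  if i = 0 then (0, 0)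
  else if i ≤ n - 2 then (i - 1, 1)
  else if i = n - 1 then (n - 2, 1 / 2)
  else if i = n then (n - 1, 1 / 2)
  else if i = n + 1 then (n - 2, 1)
  else (n - 1, 1)

/-- The vertex `v_i` of `X_0` as a point of `S`. -/
def vpt (n i : ℕ) : Sspace n := ⟨embC n (vcoord n i), Set.mem_range_self _⟩

/-- The branch point `v_0` of `S`. -/
def centerPt (n : ℕ) : Sspace n := vpt n 0

/-- Affine interpolation, in arm coordinates, between two adjacent vertices of
`X_0` (they lie on a common ray; if one of them is the branch point, the ray of
the other one is used). -/
def interpC (w w' : ℕ × ℝ) (s : ℝ) : ℕ × ℝ :=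
  (if w.2 = 0 then w'.1 else w.1, (1 - s) * w.2 + s * w'.2)

/-- Arm coordinates of the `φ`-image of the `j`-th vertex of `X_1` (counted from
`v_0` outwards) on the `a`-th arm of `X_1` (`1 ≤ a ≤ n`), following the defining
table of `φ = nφ`:

* arm `a ≤ n - 3` has vertices `v_0, u_a, u_{(n-3)+a}, …, u_{2(n-1)(n-3)+a}, v_a`;
* arm `n - 2` has vertices `v_0, u_{(2n-1)(n-3)+2(n-1)+1}, v_{n-2}`;
* arm `n - 1` has vertices `v_0, u_{(2n-1)(n-3)+2(n-1)+2}, u_{(2n-1)(n-3)+2(n-1)+3},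
  v_{n-1}, v_{n+1}`;
* arm `n` has vertices `v_0, u_{(2n-1)(n-3)+1}, …, u_{(2n-1)(n-3)+2(n-1)}, v_n, v_{n+2}`. -/
def imgCoord (n a j : ℕ) : ℕ × ℝ :=
  if a = n then
    (if j = 0 then vcoord n 0
     else if j ≤ 2 * n - 2 then
       (if j = 1 then vcoord n (n - 1)
        else if j % 2 = 0 then vcoord n 0
        else if j = 3 then vcoord n (n - 2)
        else vcoord n ((j - 3) / 2))
     else if j = 2 * n - 1 then vcoord n n
     else vcoord n (n + 2))
  else if a = n - 1 then
    (if j = 0 then vcoord n 0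
     else if j = 1 then vcoord n (n - 1)
     else if j = 2 then vcoord n 0
     else if j = 3 then vcoord n n
     else vcoord n (n + 2))
  else if a = n - 2 then
    (if j = 0 then vcoord n 0
     else if j = 1 then vcoord n (n - 1)
     else vcoord n (n + 1))
  else
    (if j = 0 then vcoord n 0
     else if j ≤ 2 * n - 1 then
       (if j = 1 then vcoord n (n - 1)
        else if j = 2 * n - 1 then vcoord n n
        else if (j - 1) % 2 = 1 then vcoord n 0
        else vcoord n ((a + (j - 1) / 2 - 2) % (n - 2) + 1))
     else vcoord n (n + 2))

/-- Locating a parameter `t ∈ [0,1]` on arm `a` of the subdivision `X_1`: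
returns the index `j` of the edge of `X_1` containing the point together with the
affine coordinate `s ∈ [0,1]` inside this edge.  The vertices of `X_1` are placed
at: `j/(2n)` (`0 ≤ j ≤ 2n`) on arms `a ≤ n-3`; at `0, 1/2, 1` on arm `n-2`;
at `0, 1/6, 2/6, 3/6, 1` on arm `n-1` (the vertices `v_{n-1}`, `v_{n+1}` sit at
`1/2` and `1`); and at `j/(4n-2)` (`0 ≤ j ≤ 2n-1`) followed by `1` on arm `n`
(the vertices `v_n`, `v_{n+2}` sit at `1/2` and `1`). -/
def segOf (n a : ℕ) (t : ℝ) : ℕ × ℝ :=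
  if a = n then
    (if t ≤ 1 / 2 then
      (min (2 * n - 2) ⌊(4 * (n : ℝ) - 2) * t⌋₊,
        (4 * (n : ℝ) - 2) * t - (min (2 * n - 2) ⌊(4 * (n : ℝ) - 2) * t⌋₊ : ℕ))
     else (2 * n - 1, 2 * t - 1))
  else if a = n - 1 then
    (if t ≤ 1 / 2 then
      (min 2 ⌊6 * t⌋₊, 6 * t - (min 2 ⌊6 * t⌋₊ : ℕ))
     else (3, 2 * t - 1))
  else if a = n - 2 then
    (min 1 ⌊2 * t⌋₊, 2 * t - (min 1 ⌊2 * t⌋₊ : ℕ))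
  else
    (min (2 * n - 1) ⌊2 * (n : ℝ) * t⌋₊,
      2 * (n : ℝ) * t - (min (2 * n - 1) ⌊2 * (n : ℝ) * t⌋₊ : ℕ))

/-- The bonding map `φ` in arm coordinates: a point with arm coordinates `p` lies
on arm `a = p.1 % n + 1` at parameter `t`; it lies in the `j`-th edge of `X_1`
on this arm with affine coordinate `s`, and is mapped to the corresponding affine
combination of the `φ`-images of the endpoints of this edge. -/
def Gmap (n : ℕ) (p : ℕ × ℝ) : ℕ × ℝ :=
  interpC (imgCoord n (p.1 % n + 1) (segOf n (p.1 % n + 1) (min 1 (max 0 p.2))).1)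
    (imgCoord n (p.1 % n + 1) ((segOf n (p.1 % n + 1) (min 1 (max 0 p.2))).1 + 1))
    (segOf n (p.1 % n + 1) (min 1 (max 0 p.2))).2

/-- The piecewise-linear bonding map `f : S → S` induced by `φ`. -/
def fS (n : ℕ) : Sspace n → Sspace n := fun z =>
  ⟨embC n (Gmap n (Function.invFun (embC n) (z : ℂ))), Set.mem_range_self _⟩

/-- The continuum `nK`: the inverse limit of the sequence `S ←f S ←f S ⋯`,
realized inside the countable product `S^ℕ`. -/
abbrev nK (n : ℕ) := {x : ℕ → Sspace n // ∀ k, fS n (x (k + 1)) = x k}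

end

noncomputable section

/-- Arm coordinates of the parametrization of the `e`-th edge of `X_0`
(`0 ≤ e ≤ n+1`): for `e < n-2` the edge is `⟨v_0, v_{e+1}⟩` (a whole ray);
edge `n-2` is `⟨v_0, v_{n-1}⟩`; edge `n-1` is `⟨v_{n-1}, v_{n+1}⟩`;
edge `n` is `⟨v_0, v_n⟩`; edge `n+1` is `⟨v_n, v_{n+2}⟩`. -/
def X0edgeCoord (n e : ℕ) (t : ℝ) : ℕ × ℝ :=
  if e < n - 2 then (e, t)
  else if e = n - 2 then (n - 2, t / 2)
  else if e = n - 1 then (n - 2, (1 + t) / 2)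
  else if e = n then (n - 1, t / 2)
  else (n - 1, (1 + t) / 2)

/-- The graph `X_0`: the simple-`n`-od `S`, with vertex set `{v_0, …, v_{n+2}}`
and the `n + 2` edges listed in `X0edgeCoord`. -/
def X0graph (n : ℕ) : GraphData (Sspace n) :=
  letI := Classical.decEq (Sspace n)
  { verts := (Finset.range (n + 3)).image (vpt n)
    nE := n + 2
    edge := fun e t => ⟨embC n (X0edgeCoord n (e : ℕ) t), Set.mem_range_self _⟩ }

end

namespace SimpleOd

/-! ### Words -/

/-- The letters read between consecutive visits of `v_0` along the `φ`-image of `⟨v_0, v_e⟩`,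
after the initial excursion to `v_{n-1}` and before the final visit of `v_n`. -/
def word (n e : ℕ) : List ℕ :=
  if e = n - 1 ∨ e = n - 2 then []
  else (List.range (n - 2)).map
    fun u => (u + (if e = n then n - 3 else e - 1)) % (n - 2) + 1

/-- Insert a return to `v_0` after every letter. -/
def inter (L : List ℕ) : List ℕ := L.flatMap fun x => [x, 0]

/-- The end of the word of `⟨v_0, v_e⟩`. -/
def suf (n e : ℕ) : List ℕ := if e < n - 2 then [n, n + 2] else [n]

/-- The vertices visited by the `φ`-image of `⟨v_0, v_e⟩` once it leaves `⟨v_0, v_{n-1}⟩`. -/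
def full (n e : ℕ) : List ℕ :=
  if e = n - 2 then [n - 1, n + 1] else inter (word n e) ++ suf n e

theorem inter_nil : inter [] = [] := rfl

theorem inter_cons (x : ℕ) (L : List ℕ) : inter (x :: L) = x :: 0 :: inter L := rfl

theorem inter_append (L L' : List ℕ) : inter (L ++ L') = inter L ++ inter L' := by
  simp [inter]

theorem word_eq {n e : ℕ} (h : ¬ (e = n - 1 ∨ e = n - 2)) :
    word n e = (List.range (n - 2)).map
      fun u => (u + (if e = n then n - 3 else e - 1)) % (n - 2) + 1 := by
  rw [word, if_neg h]

theorem add_mod_inj {c r u v : ℕ} (hu : u < c) (hv : v < c)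
    (h : (u + r) % c = (v + r) % c) : u = v := by
  have h' : u ≡ v [MOD c] := Nat.ModEq.add_right_cancel' r h
  exact Nat.ModEq.eq_of_lt_of_lt h' hu hv

theorem word_nodup (n e : ℕ) : (word n e).Nodup := by
  unfold word
  split_ifs
  · exact List.nodup_nil
  all_goals
    refine List.Nodup.map_on ?_ List.nodup_range
    intro u hu v hv h
    rw [List.mem_range] at hu hv
    exact add_mod_inj hu hv (Nat.succ_injective h)

theorem mem_word {n e x : ℕ} (hn : 3 ≤ n) (h : x ∈ word n e) : 1 ≤ x ∧ x ≤ n - 2 := by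
  unfold word at h
  split_ifs at h
  · simp at h
  all_goals
    obtain ⟨u, -, rfl⟩ := List.mem_map.1 h
    have := Nat.mod_lt (u + n - 3) (show n - 2 > 0 by omega)
    refine ⟨by omega, ?_⟩
    exact Nat.mod_lt _ (by omega)

theorem mem_word_of_ne {n e x : ℕ} (hn : 3 ≤ n) (h : ¬ (e = n - 1 ∨ e = n - 2)) (h1 : 1 ≤ x)
    (h2 : x ≤ n - 2) : x ∈ word n e := by
  have hsub : (word n e).toFinset ⊆ Finset.Icc 1 (n - 2) := by
    intro y hy
    rw [Finset.mem_Icc]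
    exact mem_word hn (List.mem_toFinset.1 hy)
  have hcard : (Finset.Icc 1 (n - 2)).card ≤ (word n e).toFinset.card := by
    rw [List.toFinset_card_of_nodup (word_nodup n e), word_eq h]
    simp
  have := Finset.eq_of_subset_of_card_le hsub hcard
  rw [← List.mem_toFinset, this]
  exact Finset.mem_Icc.2 ⟨h1, h2⟩

theorem shift_inj {n e e' : ℕ} (hn : 3 ≤ n) (he : 1 ≤ e) (he2 : e ≤ n) (he' : 1 ≤ e')
    (he2' : e' ≤ n) (h : ¬ (e = n - 1 ∨ e = n - 2)) (h' : ¬ (e' = n - 1 ∨ e' = n - 2)) (u : ℕ)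
    (heq : (u + (if e = n then n - 3 else e - 1)) % (n - 2) + 1
      = (u + (if e' = n then n - 3 else e' - 1)) % (n - 2) + 1) : e = e' := by
  have key : (if e = n then n - 3 else e - 1) = (if e' = n then n - 3 else e' - 1) := by
    apply add_mod_inj (c := n - 2) (r := u)
    · split_ifs <;> omega
    · split_ifs <;> omega
    · rw [add_comm _ u, add_comm _ u]; omega
  split_ifs at key <;> omega

/-- A word is determined by its first letter. -/
theorem word_head_inj {n e e' x : ℕ} {L L' : List ℕ} (hn : 3 ≤ n) (he : 1 ≤ e) (he2 : e ≤ n)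
    (he' : 1 ≤ e') (he2' : e' ≤ n) (h : word n e = x :: L) (h' : word n e' = x :: L') :
    e = e' := by
  have hne : ¬ (e = n - 1 ∨ e = n - 2) := fun hc => by simp [word, hc] at h
  have hne' : ¬ (e' = n - 1 ∨ e' = n - 2) := fun hc => by simp [word, hc] at h'
  rw [word_eq hne] at h
  rw [word_eq hne'] at h'
  have a := congrArg List.head? h
  have a' := congrArg List.head? h'
  rw [List.head?_map] at a a'
  rcases hr : (List.range (n - 2)).head? with _ | u
  · rw [hr] at a; simp at a
  · rw [hr] at a a'
    simp only [Option.map_some, List.head?_cons, Option.some.injEq] at a a'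
    have key := a.trans a'.symm
    exact shift_inj hn he he2 he' he2' hne hne' u key

/-- A word is determined by its last letter. -/
theorem word_last_inj {n e e' : ℕ} {L L' M : List ℕ} (hn : 3 ≤ n) (hM : M ≠ []) (he : 1 ≤ e) (he2 : e ≤ n)
    (he' : 1 ≤ e') (he2' : e' ≤ n) (h : word n e = L ++ M) (h' : word n e' = L' ++ M) :
    e = e' := by
  have hne : ¬ (e = n - 1 ∨ e = n - 2) := fun hc => by simp [word, hc] at h; tauto
  have hne' : ¬ (e' = n - 1 ∨ e' = n - 2) := fun hc => by simp [word, hc] at h'; tauto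
  rw [word_eq hne] at h
  rw [word_eq hne'] at h'
  have a := congrArg List.getLast? h
  have a' := congrArg List.getLast? h'
  rw [List.getLast?_map, List.getLast?_append_of_ne_nil _ hM] at a a'
  rcases hr : (List.range (n - 2)).getLast? with _ | u
  · rw [hr] at a; simp at a; exact absurd a.symm (by simpa using hM)
  · rw [hr] at a a'
    simp only [Option.map_some] at a a'
    exact shift_inj hn he he2 he' he2' hne hne' u (by
      have := a.trans a'.symm
      simpa using this)

/-- The first vertex of `full n e` determines `e`. -/
theorem full_head_inj {n e e' x : ℕ} {L L' : List ℕ} (hn : 3 ≤ n) (he : 1 ≤ e) (he2 : e ≤ n)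
    (he' : 1 ≤ e') (he2' : e' ≤ n) (h : full n e = x :: L) (h' : full n e' = x :: L') :
    e = e' := by
  have key : ∀ {e L}, 1 ≤ e → e ≤ n → full n e = x :: L →
      (e = n - 2 ∧ x = n - 1) ∨ (e = n - 1 ∧ x = n) ∨ (∃ M, word n e = x :: M) ∧ x ≤ n - 2 := by
    intro e L h1 h2 h
    unfold full at h
    by_cases hc : e = n - 2
    · rw [if_pos hc] at h
      simp only [List.cons.injEq] at h
      exact Or.inl ⟨hc, h.1.symm⟩
    rw [if_neg hc] at h
    by_cases hc' : e = n - 1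
    · right; left
      refine ⟨hc', ?_⟩
      have : word n e = [] := by simp [word, hc']
      rw [this, inter_nil, List.nil_append, suf, if_neg (by omega)] at h
      simp only [List.cons.injEq] at h
      exact h.1.symm
    · right; right
      rcases hw : word n e with _ | ⟨y, M⟩
      · have : 1 ∈ word n e := mem_word_of_ne hn (by tauto) le_rfl (by omega)
        rw [hw] at this; simp at this
      · rw [hw, inter_cons, List.cons_append] at h
        simp only [List.cons.injEq] at h
        obtain ⟨rfl, -⟩ := h
        exact ⟨⟨M, rfl⟩, (mem_word hn (by rw [hw]; simp)).2⟩
  rcases key he he2 h with h1 | h1 | ⟨⟨M, h1⟩, h1'⟩ <;>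
    rcases key he' he2' h' with h2 | h2 | ⟨⟨M', h2⟩, h2'⟩ <;> try omega
  exact word_head_inj hn he he2 he' he2' h1 h2

/-! ### Graphs over `X_0` as families of relations -/

variable {V W : Type}

/-- The vertex `v_{src n e}` is the endpoint other than `v_e` of the edge number `e` of `X_0`. -/
def src (n e : ℕ) : ℕ := if e = n + 1 then n - 1 else if e = n + 2 then n else 0

/-- The images of the vertices of `X_0` under `φ`. -/
def phi (n i : ℕ) : ℕ :=
  if i = 0 then 0 else if i < n - 2 then n + 2 else if i = n - 2 then n + 1
  else if i ≤ n then n else n + 2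

/-- Two vertices over `v_0` with a common neighbour over `v_x`. -/
def Twin (R : ℕ → V → V → Prop) (x : ℕ) (z w : V) : Prop := ∃ b, R x z b ∧ R x w b

/-- A walk between vertices over `v_0` visiting the letters of a list. -/
def Path (R : ℕ → V → V → Prop) : List ℕ → V → V → Prop
  | [], z, w => z = w
  | x :: L, z, w => ∃ u, Twin R x z u ∧ Path R L u w

/-- The walks in `R` spelled by the `φ`-images of the edges of `X_0`. -/
def Der (n : ℕ) (R : ℕ → V → V → Prop) (e : ℕ) (t q : V) : Prop :=
  1 ≤ e ∧ e ≤ n + 2 ∧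
  if n < e then R (n + 2) t q
  else if e = n - 2 then ∃ a, R (n - 1) t a ∧ R (n + 1) a q
  else ∃ z w y, Twin R (n - 1) t z ∧ Path R (word n e) z w ∧ R n w y ∧
    if e < n - 2 then R (n + 2) y q else y = q

/-- Morphisms of graphs over `X_0`. -/
def IsHom (n : ℕ) (R : ℕ → V → V → Prop) (R' : ℕ → W → W → Prop) (π : ℕ → V → W) : Prop :=
  ∀ e x y, R e x y → R' e (π (src n e) x) (π e y)

theorem src_of_le {n e : ℕ} (h : e ≤ n) : src n e = 0 := by
  unfold src; split_ifs <;> omega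

theorem IsHom.path {n : ℕ} {R : ℕ → V → V → Prop} {R' : ℕ → W → W → Prop} {π : ℕ → V → W}
    (h : IsHom n R R' π) : ∀ {L : List ℕ} {z w : V}, (∀ x ∈ L, x ≤ n) → Path R L z w →
      Path R' L (π 0 z) (π 0 w)
  | [], z, w, _, hp => by cases hp; rfl
  | x :: L, z, w, hL, ⟨u, ⟨b, h1, h2⟩, hp⟩ => by
    have hx := src_of_le (hL x (by simp))
    refine ⟨π 0 u, ⟨π x b, ?_, ?_⟩, h.path (fun y hy => hL y (by simp [hy])) hp⟩
    · simpa [hx] using h x z b h1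
    · simpa [hx] using h x u b h2

theorem IsHom.der {n : ℕ} (hn : 3 ≤ n) {R : ℕ → V → V → Prop} {R' : ℕ → W → W → Prop}
    {π : ℕ → V → W} (h : IsHom n R R' π) :
    IsHom n (Der n R) (Der n R') fun τ => π (phi n τ) := by
  rintro e t q ⟨h1, h2, hd⟩
  refine ⟨h1, h2, ?_⟩
  by_cases he : n < e
  · rw [if_pos he] at hd ⊢
    have e1 : phi n (src n e) = src n (n + 2) := by
      unfold phi src; split_ifs <;> omega
    have e2 : phi n e = n + 2 := by unfold phi; split_ifs <;> omega
    simp only [e1, e2]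
    exact h _ _ _ hd
  rw [if_neg he] at hd ⊢
  have e0 : phi n (src n e) = 0 := by rw [src_of_le (by omega)]; simp [phi]
  have s1 : src n (n - 1) = 0 := src_of_le (by omega)
  have s2 : src n n = 0 := src_of_le le_rfl
  have s3 : src n (n + 1) = n - 1 := by simp [src]
  have s4 : src n (n + 2) = n := by simp [src]
  by_cases he' : e = n - 2
  · rw [if_pos he'] at hd ⊢
    obtain ⟨a, ha, hq⟩ := hd
    have e2 : phi n e = n + 1 := by unfold phi; split_ifs <;> omega
    simp only [e0, e2]
    refine ⟨π (n - 1) a, ?_, ?_⟩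
    · simpa [s1] using h _ _ _ ha
    · simpa [s3] using h _ _ _ hq
  rw [if_neg he'] at hd ⊢
  obtain ⟨z, w, y, ⟨a, ha, ha'⟩, hp, hy, hq⟩ := hd
  simp only [e0]
  refine ⟨π 0 z, π 0 w, π n y, ⟨π (n - 1) a, ?_, ?_⟩,
    h.path (fun x hx => by have := mem_word hn hx; omega) hp, ?_, ?_⟩
  · simpa [s1] using h _ _ _ ha
  · simpa [s1] using h _ _ _ ha'
  · simpa [s2] using h _ _ _ hy
  · by_cases hc : e < n - 2
    · have e2 : phi n e = n + 2 := by unfold phi; split_ifs <;> omega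
      rw [if_pos hc] at hq ⊢
      simp only [e2]
      simpa [s4] using h _ _ _ hq
    · have e2 : phi n e = n := by unfold phi; split_ifs <;> omega
      rw [if_neg hc] at hq ⊢
      rw [hq]
      simp only [e2]

theorem IsHom.iterate {n : ℕ} (hn : 3 ≤ n) (m : ℕ) : ∀ {R : ℕ → V → V → Prop}
    {R' : ℕ → W → W → Prop} {π : ℕ → V → W}, IsHom n R R' π →
    ∃ π' : ℕ → V → W, IsHom n ((Der n)^[m] R) ((Der n)^[m] R') π' := by
  induction m with
  | zero => exact fun h => ⟨_, h⟩
  | succ m ih => exact fun h => ih (h.der hn)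

/-! ### Simple-od structures -/

/-- A structure of (a disjoint union of) simple-ods with fewer than `n` arms over `X_0`: every
vertex other than a center has at most one child, and the children of a center lie on
different arms. -/
structure OdStr (n : ℕ) (R : ℕ → V → V → Prop) where
  typ : V → ℕ
  cen : V → Prop
  /-- `par v w` says that `w` is the neighbour of `v` on the side of the center. -/
  par : V → V → Prop
  arm : V → ℕ
  edge : ∀ {e x y}, R e x y →
    1 ≤ e ∧ e ≤ n + 2 ∧ typ x = src n e ∧ typ y = e ∧ (par x y ∨ par y x)
  par_unique : ∀ {v w w'}, par v w → par v w' → w = w'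
  child_unique : ∀ {v v' w}, par v w → par v' w → ¬ cen w → v = v'
  arm_inj : ∀ {v v' w}, cen w → par v w → par v' w → arm v = arm v' → v = v'
  arm_par : ∀ {v w}, par v w → ¬ cen w → arm v = arm w
  cen_par : ∀ {v w}, par v w → ¬ cen v
  cen_typ : ∀ {v}, cen v → typ v = 0
  arm_lt : ∀ v, arm v < n - 1

/-- Walks along a relation, with prescribed labels. -/
def Rd (r : V → V → Prop) (typ : V → ℕ) : List ℕ → V → V → Prop
  | [], v, w => v = w
  | x :: l, v, w => ∃ u, r u v ∧ typ u = x ∧ Rd r typ l u w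

theorem Rd.append {r : V → V → Prop} {typ : V → ℕ} {l l' : List ℕ} {v w : V} :
    Rd r typ (l ++ l') v w ↔ ∃ u, Rd r typ l v u ∧ Rd r typ l' u w := by
  induction l generalizing v with
  | nil => simp [Rd]
  | cons x l ih =>
    simp only [List.cons_append, Rd, ih]
    constructor
    · rintro ⟨u, h1, h2, u', h3, h4⟩; exact ⟨u', ⟨u, h1, h2, h3⟩, h4⟩
    · rintro ⟨u', ⟨u, h1, h2, h3⟩, h4⟩; exact ⟨u, h1, h2, u', h3, h4⟩

theorem Rd.singleton {r : V → V → Prop} {typ : V → ℕ} {x : ℕ} {v w : V} :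
    Rd r typ [x] v w ↔ r w v ∧ typ w = x := by
  simp [Rd]

/-- The end of a walk spelled by `inter L` has label `0`. -/
theorem Rd.typ_inter {r : V → V → Prop} {typ : V → ℕ} {L : List ℕ} {v w : V}
    (h : Rd r typ (inter L) v w) (hv : typ v = 0) : typ w = 0 := by
  induction L generalizing v with
  | nil => cases h; exact hv
  | cons x L ih =>
    obtain ⟨u, -, -, u', -, h2, h3⟩ := h
    exact ih h3 h2

namespace OdStr

variable {n : ℕ} {R : ℕ → V → V → Prop} (O : OdStr n R)

/-- Walks away from the center. -/
abbrev URead : List ℕ → V → V → Prop := Rd O.par O.typ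

/-- Walks towards the center. -/
abbrev DRead : List ℕ → V → V → Prop := Rd (fun u v => O.par v u) O.typ

/-- `s` has a child labelled `x`. -/
def HasChild (s : V) (x : ℕ) : Prop := ∃ b, O.par b s ∧ O.typ b = x

/-- A vertex which is not a center has at most two neighbours. -/
theorem not_three {z a b c : V} (hz : ¬ O.cen z) (ha : O.par a z ∨ O.par z a)
    (hb : O.par b z ∨ O.par z b) (hd : O.par c z ∨ O.par z c) (hab : O.typ a ≠ O.typ b)
    (hac : O.typ a ≠ O.typ c) (hbc : O.typ b ≠ O.typ c) : False := by
  rcases ha with ha | ha <;> rcases hb with hb | hb <;> rcases hd with hd | hd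
  all_goals first
    | (have := O.child_unique ha hb hz; subst this; omega)
    | (have := O.child_unique ha hd hz; subst this; omega)
    | (have := O.child_unique hb hd hz; subst this; omega)
    | (have := O.par_unique ha hb; subst this; omega)
    | (have := O.par_unique ha hd; subst this; omega)
    | (have := O.par_unique hb hd; subst this; omega)

theorem not_full (hn : 3 ≤ n) (v : V)
    (h : ∀ x, 1 ≤ x → x ≤ n → ∃ b, (O.par b v ∨ O.par v b) ∧ O.typ b = x) : False := by
  classical
  by_cases hc : O.cen v
  · have h' : ∀ x : Fin n, ∃ b, O.par b v ∧ O.typ b = x + 1 := by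
      intro x
      obtain ⟨b, hb, hx⟩ := h (x + 1) (by omega) (by omega)
      exact ⟨b, hb.resolve_right fun h => O.cen_par h hc, hx⟩
    choose b hb hx using h'
    let g : Fin n → Fin (n - 1) := fun x => ⟨O.arm (b x), O.arm_lt _⟩
    obtain ⟨x, y, hne, hxy⟩ := Fintype.exists_ne_map_eq_of_card_lt g (by simp; omega)
    have := O.arm_inj hc (hb x) (hb y) (Fin.mk.inj_iff.1 hxy)
    have h1 := hx x
    rw [this, hx y] at h1
    exact hne (Fin.ext (by omega))
  · obtain ⟨a, ha, h1⟩ := h 1 le_rfl (by omega)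
    obtain ⟨b, hb, h2⟩ := h 2 (by omega) (by omega)
    obtain ⟨c, hd, h3⟩ := h 3 (by omega) hn
    exact O.not_three hc ha hb hd (by omega) (by omega) (by omega)

variable {O}

theorem not_cen_of_typ {v : V} (h : O.typ v ≠ 0) : ¬ O.cen v := fun hc => h (O.cen_typ hc)

theorem URead.not_cen {l : List ℕ} {v q : V} (hl : l ≠ []) (h : O.URead l v q) : ¬ O.cen q := by
  induction l generalizing v with
  | nil => exact absurd rfl hl
  | cons x l ih =>
    obtain ⟨u, h1, -, h3⟩ := h
    rcases eq_or_ne l [] with rfl | hl'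
    · cases h3; exact O.cen_par h1
    · exact ih hl' h3

theorem URead.arm_eq {l : List ℕ} {v q : V} (hv : ¬ O.cen v) (h : O.URead l v q) :
    O.arm q = O.arm v := by
  induction l generalizing v with
  | nil => cases h; rfl
  | cons x l ih =>
    obtain ⟨u, h1, -, h3⟩ := h
    rw [ih (O.cen_par h1) h3, O.arm_par h1 hv]

theorem DRead.arm_eq {l : List ℕ} {v q : V} (hq : ¬ O.cen q) (h : O.DRead l v q) :
    O.arm q = O.arm v := by
  induction l generalizing v with
  | nil => cases h; rfl
  | cons x l ih =>
    obtain ⟨u, h1, -, h3⟩ := h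
    have hu : ¬ O.cen u := by
      cases l with
      | nil => cases h3; exact hq
      | cons y l => obtain ⟨w, h4, -⟩ := h3; exact O.cen_par h4
    rw [ih h3, O.arm_par h1 hu]

theorem URead.rev_det {l : List ℕ} {z z' q : V} (h : O.URead l z q) (h' : O.URead l z' q) :
    z = z' := by
  induction l generalizing z z' with
  | nil => cases h; cases h'; rfl
  | cons x l ih =>
    obtain ⟨u, h1, -, h3⟩ := h
    obtain ⟨u', h1', -, h3'⟩ := h'
    cases ih h3 h3'
    exact O.par_unique h1 h1'

theorem DRead.rev_det {l : List ℕ} {z z' q : V} (hq : ¬ O.cen q) (h : O.DRead l z q)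
    (h' : O.DRead l z' q) : z = z' := by
  induction l generalizing z z' with
  | nil => cases h; cases h'; rfl
  | cons x l ih =>
    obtain ⟨u, h1, -, h3⟩ := h
    obtain ⟨u', h1', -, h3'⟩ := h'
    cases ih h3 h3'
    refine O.child_unique h1 h1' ?_
    cases l with
    | nil => cases h3; exact hq
    | cons y l => obtain ⟨w, h4, -⟩ := h3; exact O.cen_par h4

theorem DRead.det {l : List ℕ} {z q q' : V} (h : O.DRead l z q) (h' : O.DRead l z q') :
    q = q' := by
  induction l generalizing z with
  | nil => cases h; cases h'; rfl
  | cons x l ih =>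
    obtain ⟨u, h1, -, h3⟩ := h
    obtain ⟨u', h1', -, hu⟩ := h'
    cases O.par_unique h1 h1'
    exact ih h3 hu

/-- The first children on the ways to two vertices of the same arm agree. -/
theorem first_child_eq {l l' : List ℕ} {v u u' q q' : V} (hu : O.par u v) (hu' : O.par u' v)
    (h : O.URead l u q) (h' : O.URead l' u' q') (ha : O.arm q = O.arm q') : u = u' := by
  by_cases hv : O.cen v
  · refine O.arm_inj hv hu hu' ?_
    rw [← URead.arm_eq (O.cen_par hu) h, ← URead.arm_eq (O.cen_par hu') h', ha]
  · exact O.child_unique hu hu' hv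

theorem URead.det {l : List ℕ} {z q q' : V} (h : O.URead l z q) (h' : O.URead l z q')
    (ha : O.arm q = O.arm q') : q = q' := by
  induction l generalizing z with
  | nil => cases h; cases h'; rfl
  | cons x l ih =>
    obtain ⟨u, h1, -, h3⟩ := h
    obtain ⟨u', h1', -, hu⟩ := h'
    cases first_child_eq h1 h1' h3 hu ha
    exact ih h3 hu

/-- The head of the list spelling a walk away from the center. -/
theorem URead.cons_inj {x x' : ℕ} {l l' : List ℕ} {z q q' : V} (h : O.URead (x :: l) z q)
    (h' : O.URead (x' :: l') z q') (ha : O.arm q = O.arm q') :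
    x = x' ∧ ∃ u, O.par u z ∧ O.typ u = x ∧ O.URead l u q ∧ O.URead l' u q' := by
  obtain ⟨u, h1, h2, h3⟩ := h
  obtain ⟨u', h1', h2', hu⟩ := h'
  cases first_child_eq h1 h1' h3 hu ha
  exact ⟨h2.symm.trans h2', u, h1, h2, h3, hu⟩

/-- The last step of a walk spelled by `inter L ++ [x]` starts at a vertex labelled `0`. -/
theorem _root_.SimpleOd.Rd.last {r : V → V → Prop} {typ : V → ℕ} {L : List ℕ} {x : ℕ} {z q : V}
    (h : Rd r typ (inter L ++ [x]) z q) (hz : typ z = 0) : ∃ y, r q y ∧ typ y = 0 := by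
  obtain ⟨y, h1, h2⟩ := Rd.append.1 h
  exact ⟨y, (Rd.singleton.1 h2).1, h1.typ_inter hz⟩

theorem DRead.reverse {L : List ℕ} {z s : V} (h : O.DRead (inter L) z s) (hz : O.typ z = 0) :
    O.URead (inter L.reverse) s z := by
  induction L generalizing z with
  | nil => cases h; rfl
  | cons x L ih =>
    obtain ⟨u, h1, h2, u', h3, h4, h5⟩ := h
    rw [List.reverse_cons, inter_append]
    exact Rd.append.2 ⟨u', ih h5 h4, u, h3, h2, z, h1, hz, rfl⟩

theorem URead.two_read {M M' : List ℕ} {p p' : ℕ} {v y y' : V}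
    (h : O.URead (inter M ++ [p]) v y) (h' : O.URead (inter M' ++ [p']) v y')
    (ha : O.arm y = O.arm y') (hp : p ∉ M') (hp' : p' ∉ M) : M = M' ∧ p = p' ∧ y = y' := by
  induction M generalizing v M' with
  | nil =>
    cases M' with
    | nil =>
      obtain ⟨rfl, u, -, -, h3, h3'⟩ := URead.cons_inj h h' ha
      cases h3; cases h3'; exact ⟨rfl, rfl, rfl⟩
    | cons x' M' =>
      obtain ⟨rfl, -⟩ := URead.cons_inj h h' ha
      simp at hp
  | cons x M ih =>
    cases M' with
    | nil =>
      obtain ⟨rfl, -⟩ := URead.cons_inj h h' ha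
      simp at hp'
    | cons x' M' =>
      obtain ⟨rfl, u, -, -, h3, h3'⟩ := URead.cons_inj h h' ha
      obtain ⟨-, u', -, -, h4, h4'⟩ := URead.cons_inj h3 h3' ha
      obtain ⟨rfl, rfl, rfl⟩ := ih h4 h4' (fun h => hp (by simp [h])) (fun h => hp' (by simp [h]))
      exact ⟨rfl, rfl, rfl⟩

/-! ### Walks spelled by words -/

theorem edge0 {e : ℕ} {x y : V} (he : e ≤ n) (h : R e x y) :
    O.typ x = 0 ∧ O.typ y = e ∧ (O.par x y ∨ O.par y x) := by
  obtain ⟨-, -, h1, h2, h3⟩ := O.edge h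
  exact ⟨h1.trans (src_of_le he), h2, h3⟩

/-- The first step of a walk `Path R L z w` followed by an edge to `y`. -/
theorem first_nbr {L : List ℕ} {x : ℕ} {z w y : V} (hL : ∀ u ∈ L, u ≤ n) (hx : x ≤ n)
    (h : Path R L z w) (hy : R x w y) :
    ∃ b, (O.par b z ∨ O.par z b) ∧ O.typ b = (L ++ [x]).head (by simp) := by
  cases L with
  | nil =>
    cases h
    obtain ⟨-, h2, h3⟩ := O.edge0 hx hy
    exact ⟨y, h3.symm, h2⟩
  | cons u L =>
    obtain ⟨z', ⟨b, hb, -⟩, -⟩ := h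
    obtain ⟨-, h2, h3⟩ := O.edge0 (hL u (by simp)) hb
    exact ⟨b, h3.symm, h2⟩

theorem head_append_ne {L : List ℕ} {x c : ℕ} (h : x ∉ L) (hx : x ≠ c) :
    x ≠ (L ++ [c]).head (by simp) := by
  cases L with
  | nil => simpa using hx
  | cons u L => simp at h ⊢; tauto

theorem up_run {L : List ℕ} {z w y a : V} (hL : ∀ x ∈ L, x < n) (hnd : L.Nodup)
    (hp : O.par z a) (ha : O.typ a ∉ L) (han : O.typ a ≠ n) (h : Path R L z w) (hy : R n w y) :
    O.URead (inter L ++ [n]) z y := by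
  induction L generalizing z a with
  | nil =>
    cases h
    obtain ⟨-, h2, h3⟩ := O.edge0 le_rfl hy
    rcases h3 with h3 | h3
    · cases O.par_unique hp h3; exact absurd h2 han
    · exact Rd.singleton.2 ⟨h3, h2⟩
  | cons x L ih =>
    obtain ⟨u, ⟨b, hb, hb'⟩, h⟩ := h
    have hx : x < n := hL x (by simp)
    obtain ⟨-, hbt, hzb⟩ := O.edge0 hx.le hb
    obtain ⟨hu, -, hub⟩ := O.edge0 hx.le hb'
    rw [List.nodup_cons] at hnd
    simp only [List.mem_cons, not_or] at ha
    have hzb : O.par b z := by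
      rcases hzb with h3 | h3
      · cases O.par_unique hp h3; exact absurd hbt ha.1
      · exact h3
    rcases hub with hub | hub
    · exact ⟨b, hzb, hbt, u, hub, hu, ih (fun x h => hL x (by simp [h])) hnd.2 hub
        (by rw [hbt]; exact hnd.1) (by omega) h⟩
    · cases O.par_unique hzb hub
      obtain ⟨d, hd, hdt⟩ := O.first_nbr (fun x h => (hL x (by simp [h])).le) le_rfl h hy
      refine (O.not_three (O.cen_par hp) (.inr hp) (.inl hzb) hd ?_ ?_ ?_).elim
      · rw [hbt]; exact ha.1
      · rw [hdt]; exact head_append_ne ha.2 han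
      · rw [hdt, hbt]; exact head_append_ne hnd.1 hx.ne

theorem center_run {L : List ℕ} {s w y : V} (hL : ∀ x ∈ L, x < n) (hnd : L.Nodup)
    (hs : O.cen s) (h : Path R L s w) (hy : R n w y) :
    ∃ L2 L3, L = L2 ++ L3 ∧ (∀ x ∈ L2, O.HasChild s x) ∧ O.URead (inter L3 ++ [n]) s y := by
  induction L with
  | nil =>
    cases h
    obtain ⟨-, h2, h3⟩ := O.edge0 le_rfl hy
    exact ⟨[], [], rfl, by simp,
      Rd.singleton.2 ⟨h3.resolve_left fun h => O.cen_par h hs, h2⟩⟩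
  | cons x L ih =>
    obtain ⟨u, ⟨b, hb, hb'⟩, h⟩ := h
    have hx : x < n := hL x (by simp)
    obtain ⟨-, hbt, hzb⟩ := O.edge0 hx.le hb
    obtain ⟨hu, -, hub⟩ := O.edge0 hx.le hb'
    rw [List.nodup_cons] at hnd
    replace hzb := hzb.resolve_left fun h => O.cen_par h hs
    have hL' : ∀ x ∈ L, x < n := fun x h => hL x (by simp [h])
    rcases hub with hub | hub
    · exact ⟨[], x :: L, rfl, by simp, b, hzb, hbt, u, hub, hu,
        up_run hL' hnd.2 hub (by rw [hbt]; exact hnd.1) (by omega) h hy⟩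
    · cases O.par_unique hzb hub
      obtain ⟨L2, L3, rfl, h2, h3⟩ := ih hL' hnd.2 h
      refine ⟨x :: L2, L3, rfl, ?_, h3⟩
      intro x' hx'
      rcases List.mem_cons.1 hx' with rfl | hx'
      · exact ⟨b, hzb, hbt⟩
      · exact h2 x' hx'

theorem down_run {L : List ℕ} {z w y a : V} (hL : ∀ x ∈ L, x < n) (hnd : L.Nodup)
    (hz : ¬ O.cen z) (hp : O.par a z) (ha : O.typ a ∉ L) (han : O.typ a ≠ n)
    (h : Path R L z w) (hy : R n w y) :
    O.DRead (inter L ++ [n]) z y ∨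
      ∃ L1 L' s, L = L1 ++ L' ∧ L1 ≠ [] ∧ O.DRead (inter L1) z s ∧ O.cen s ∧ Path R L' s w := by
  induction L generalizing z a with
  | nil =>
    cases h
    obtain ⟨-, h2, h3⟩ := O.edge0 le_rfl hy
    rcases h3 with h3 | h3
    · exact .inl (Rd.singleton.2 ⟨h3, h2⟩)
    · cases O.child_unique hp h3 hz; exact absurd h2 han
  | cons x L ih =>
    obtain ⟨u, ⟨b, hb, hb'⟩, h⟩ := h
    have hx : x < n := hL x (by simp)
    obtain ⟨-, hbt, hzb⟩ := O.edge0 hx.le hb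
    obtain ⟨hu, -, hub⟩ := O.edge0 hx.le hb'
    rw [List.nodup_cons] at hnd
    simp only [List.mem_cons, not_or] at ha
    have hzb : O.par z b := by
      rcases hzb with h3 | h3
      · exact h3
      · cases O.child_unique hp h3 hz; exact absurd hbt ha.1
    have hfold : u = z → O.DRead (inter (x :: L) ++ [n]) z y ∨
        ∃ L1 L' s, x :: L = L1 ++ L' ∧ L1 ≠ [] ∧ O.DRead (inter L1) z s ∧ O.cen s ∧
          Path R L' s w := by
      rintro rfl
      obtain ⟨d, hd, hdt⟩ := O.first_nbr (fun x h => (hL x (by simp [h])).le) le_rfl h hy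
      refine (O.not_three hz (.inl hp) (.inr hzb) hd ?_ ?_ ?_).elim
      · rw [hbt]; exact ha.1
      · rw [hdt]; exact head_append_ne ha.2 han
      · rw [hdt, hbt]; exact head_append_ne hnd.1 hx.ne
    rcases hub with hub | hub
    · by_cases hbc : O.cen b
      · have hb0 := O.cen_typ hbc
        obtain ⟨h1, -⟩ := O.edge hb
        omega
      · exact hfold (O.child_unique hub hzb hbc)
    · by_cases huc : O.cen u
      · exact .inr ⟨[x], L, u, rfl, by simp, ⟨b, hzb, hbt, u, hub, hu, rfl⟩, huc, h⟩
      · rcases ih (fun x h => hL x (by simp [h])) hnd.2 huc hub (by rw [hbt]; exact hnd.1)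
          (by omega) h with h' | ⟨L1, L', s, rfl, h1, h2, h3, h4⟩
        · exact .inl ⟨b, hzb, hbt, u, hub, hu, h'⟩
        · exact .inr ⟨x :: L1, L', s, rfl, by simp, ⟨b, hzb, hbt, u, hub, hu, h2⟩, h3, h4⟩

/-- The last step of the walks spelled by the `φ`-images of the edges of `X_0`. -/
theorem up_tail {e : ℕ} {L : List ℕ} {z y q : V} (hn : 3 ≤ n) (hz : O.typ z = 0)
    (h : O.URead (inter L ++ [n]) z y) (hq : if e < n - 2 then R (n + 2) y q else y = q) :
    O.URead (inter L ++ suf n e) z q := by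
  unfold suf
  by_cases he : e < n - 2
  · rw [if_pos he] at hq ⊢
    obtain ⟨-, -, hyt, hqt, hyq⟩ := O.edge hq
    obtain ⟨w, hw, hwt⟩ := h.last hz
    rcases hyq with hyq | hyq
    · cases O.par_unique hw hyq; omega
    · have := Rd.append.2 ⟨y, h, Rd.singleton.2 ⟨hyq, hqt⟩⟩
      simpa using this
  · rw [if_neg he] at hq ⊢
    cases hq; exact h

theorem down_tail {e : ℕ} {L : List ℕ} {z y q : V} (hn : 3 ≤ n) (hz : O.typ z = 0)
    (h : O.DRead (inter L ++ [n]) z y) (hq : if e < n - 2 then R (n + 2) y q else y = q) :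
    O.DRead (inter L ++ suf n e) z q := by
  unfold suf
  by_cases he : e < n - 2
  · rw [if_pos he] at hq ⊢
    obtain ⟨-, -, hyt, hqt, hyq⟩ := O.edge hq
    obtain ⟨w, hw, hwt⟩ := h.last hz
    rcases hyq with hyq | hyq
    · have := Rd.append.2 ⟨y, h, Rd.singleton (r := fun u v => O.par v u).2 ⟨hyq, hqt⟩⟩
      simpa using this
    · have hyc : ¬ O.cen y := not_cen_of_typ (by
        rw [hyt]; simp only [src]; split_ifs <;> omega)
      cases O.child_unique hw hyq hyc; omega
  · rw [if_neg he] at hq ⊢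
    cases hq; exact h

/-! ### Blocks -/

variable (O) in
/-- The vertex `t` over `v_0` lies next to `t'` on the side of the center, across a vertex over
`v_{n-1}`. -/
def Jd (t' t : V) : Prop :=
  ∃ a, O.par t' a ∧ O.typ a = n - 1 ∧ O.par a t ∧ O.typ t = 0 ∧ O.typ t' = 0

variable (O) in
/-- The vertices `t` and `t'` are joined by a walk folded onto the edge `⟨v_0, v_{n-1}⟩`. -/
def Bl : V → V → Prop := Relation.Join (Relation.ReflTransGen O.Jd)

theorem Jd.unique {t u u' : V} (h : O.Jd t u) (h' : O.Jd t u') : u = u' := by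
  obtain ⟨a, h1, -, h2, -⟩ := h
  obtain ⟨a', h1', -, h2', -⟩ := h'
  cases O.par_unique h1 h1'
  exact O.par_unique h2 h2'

theorem Jd.not_cen {t u : V} (h : O.Jd t u) : ¬ O.cen t := by
  obtain ⟨a, h1, -⟩ := h; exact O.cen_par h1

theorem Jd.arm_eq {t u : V} (h : O.Jd t u) (hu : ¬ O.cen u) :
    O.arm t = O.arm u := by
  obtain ⟨a, h1, h2, h3, -⟩ := h
  rw [O.arm_par h1 (O.cen_par h3), O.arm_par h3 hu]

theorem Bl.equivalence : Equivalence O.Bl := by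
  refine Relation.equivalence_join_reflTransGen fun a b c hb hd => ?_
  cases hb.unique hd
  exact ⟨b, .refl, .refl⟩

theorem Bl.refl (t : V) : O.Bl t t := Bl.equivalence.refl t

theorem Bl.symm {t u : V} (h : O.Bl t u) : O.Bl u t := Bl.equivalence.symm h

theorem Bl.trans {t u v : V} (h : O.Bl t u) (h' : O.Bl u v) : O.Bl t v :=
  Bl.equivalence.trans h h'

theorem Jd.bl {t u : V} (h : O.Jd t u) : O.Bl t u := ⟨u, .single h, .refl⟩

theorem twin_bl {t z : V} (hn : 3 ≤ n) (h : Twin R (n - 1) t z) : O.Bl t z := by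
  obtain ⟨a, h1, h2⟩ := h
  obtain ⟨ht, ha, h1⟩ := O.edge0 (by omega) h1
  obtain ⟨hz, -, h2⟩ := O.edge0 (by omega) h2
  have hac : ¬ O.cen a := not_cen_of_typ (by omega)
  rcases h1 with h1 | h1 <;> rcases h2 with h2 | h2
  · cases O.child_unique h1 h2 hac; exact Bl.refl _
  · exact Jd.bl ⟨a, h1, ha, h2, hz, ht⟩
  · exact (Jd.bl ⟨a, h2, ha, h1, ht, hz⟩).symm
  · cases O.par_unique h1 h2; exact Bl.refl _

variable (O) in
/-- The lowest elements of the blocks. -/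
def Low (t : V) : Prop := ∀ u, ¬ O.Jd t u

theorem Low.rtg_eq {t u : V} (h : O.Low t) (h' : Relation.ReflTransGen O.Jd t u) : t = u := by
  rcases Relation.ReflTransGen.cases_head h' with h1 | ⟨v, h1, -⟩
  · exact h1
  · exact absurd h1 (h v)

theorem Low.eq {t u : V} (h : O.Low t) (h' : O.Low u) (hb : O.Bl t u) : t = u := by
  obtain ⟨c, h1, h2⟩ := hb
  rw [h.rtg_eq h1, h'.rtg_eq h2]

theorem low_of_cen {s : V} (h : O.cen s) : O.Low s := fun _ hu => hu.not_cen h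

variable (O) in
/-- `z` is the uppermost vertex of its block on the arm `δ`. -/
def Top (δ : ℕ) (z : V) : Prop := ∀ v, O.Jd v z → O.arm v ≠ δ

theorem rtg_arm {δ : ℕ} {z c : V} (hz : O.cen z ∨ O.arm z = δ)
    (h : Relation.ReflTransGen O.Jd z c) :
    Relation.ReflTransGen (fun u v => O.Jd v u ∧ O.arm v = δ) c z := by
  induction h using Relation.ReflTransGen.head_induction_on with
  | refl => exact .refl
  | @head a b h1 h2 ih =>
    have ha := hz.resolve_left h1.not_cen
    refine (ih ?_).tail ⟨h1, ha⟩
    by_cases hc : O.cen b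
    · exact .inl hc
    · exact .inr ((h1.arm_eq hc).symm.trans ha)

theorem tops_eq {δ : ℕ} {z z' : V} (hb : O.Bl z z') (hz : O.cen z ∨ O.arm z = δ)
    (hz' : O.cen z' ∨ O.arm z' = δ) (ht : O.Top δ z) (ht' : O.Top δ z') : z = z' := by
  obtain ⟨c, h1, h2⟩ := hb
  have hu : Relator.RightUnique fun u v => O.Jd v u ∧ O.arm v = δ := by
    rintro u v v' ⟨⟨a, h1, h2, h3, -⟩, hv⟩ ⟨⟨a', h1', h2', h3', -⟩, hv'⟩
    have e1 := O.arm_par h1 (O.cen_par h3)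
    have e2 := O.arm_par h1' (O.cen_par h3')
    have : a = a' := by
      by_cases hc : O.cen u
      · exact O.arm_inj hc h3 h3' (by omega)
      · exact O.child_unique h3 h3' hc
    subst this
    exact O.child_unique h1 h1' (O.cen_par h3)
  rcases Relation.ReflTransGen.total_of_right_unique hu (rtg_arm hz h1) (rtg_arm hz' h2)
    with h | h <;> rcases Relation.ReflTransGen.cases_head h with h | ⟨v, ⟨h, h'⟩, -⟩
  · exact h
  · exact absurd h' (ht v h)
  · exact h.symm
  · exact absurd h' (ht' v h)

theorem full_cons (hn : 3 ≤ n) (e : ℕ) : ∃ x l, full n e = x :: l ∧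
    ((x = n - 1 ∧ l = [n + 1]) ∨ x ≠ n - 1) := by
  unfold full
  split_ifs with h
  · exact ⟨_, _, rfl, .inl ⟨rfl, rfl⟩⟩
  rcases hw : word n e with _ | ⟨y, M⟩
  · rw [inter_nil, List.nil_append, suf]
    split_ifs
    · exact ⟨_, _, rfl, .inr (by omega)⟩
    · exact ⟨_, _, rfl, .inr (by omega)⟩
  · have := mem_word hn (show y ∈ word n e by rw [hw]; simp)
    exact ⟨y, _, rfl, .inr (by omega)⟩

theorem URead.top {e : ℕ} {z q : V} (hn : 3 ≤ n) (h : O.URead (full n e) z q) :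
    O.Top (O.arm q) z := by
  rintro v ⟨a, h1, h2, h3, h4, h5⟩ hv
  obtain ⟨x, l, hx, hl⟩ := full_cons hn e
  rw [hx] at h
  have h' : O.URead ((n - 1) :: [0]) z v := ⟨a, h3, h2, v, h1, h5, rfl⟩
  obtain ⟨rfl, u, -, -, h6, h6'⟩ := URead.cons_inj h h' hv.symm
  obtain ⟨-, rfl⟩ | h7 := hl
  · obtain ⟨h7, -⟩ := URead.cons_inj h6 h6' hv.symm
    omega
  · exact h7 rfl

theorem DRead.low {e : ℕ} {z q : V} (hn : 3 ≤ n) (h : O.DRead (full n e) z q) :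
    O.Low z := by
  rintro v ⟨a, h1, h2, h3, h4, h5⟩
  obtain ⟨x, l, hx, hl⟩ := full_cons hn e
  rw [hx] at h
  obtain ⟨u, h6, h7, h8⟩ := h
  cases O.par_unique h6 h1
  obtain ⟨-, rfl⟩ | h9 := hl
  · obtain ⟨h8, h9⟩ := Rd.singleton.1 h8
    cases O.par_unique h8 h3
    omega
  · omega

/-- Walks away from the center out of one block, to the same arm, agree. -/
theorem up_inj {e e' : ℕ} {z z' q q' : V} (hn : 3 ≤ n) (he : 1 ≤ e) (hen : e ≤ n) (he' : 1 ≤ e')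
    (hen' : e' ≤ n) (hb : O.Bl z z') (h : O.URead (full n e) z q)
    (h' : O.URead (full n e') z' q') (ha : O.arm q = O.arm q') : e = e' ∧ q = q' := by
  have hz : z = z' := by
    refine tops_eq (δ := O.arm q) hb ?_ ?_ (h.top hn) (ha ▸ h'.top hn)
    · by_cases hc : O.cen z
      · exact .inl hc
      · exact .inr (h.arm_eq hc).symm
    · by_cases hc : O.cen z'
      · exact .inl hc
      · exact .inr ((h'.arm_eq hc).symm.trans ha.symm)
  subst hz
  have hee : e = e' := by
    obtain ⟨x, l, hx, -⟩ := full_cons hn e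
    obtain ⟨x', l', hx', -⟩ := full_cons hn e'
    have h1 := h
    have h1' := h'
    rw [hx] at h1
    rw [hx'] at h1'
    obtain ⟨rfl, -⟩ := URead.cons_inj h1 h1' ha
    exact full_head_inj hn he hen he' hen' hx hx'
  subst hee
  have hq := h.det h' ha
  exact ⟨rfl, hq⟩

/-! ### Central classes -/

variable (O) in
/-- `s` has children labelled `n - 1` and by the letters of `L`. -/
def Link (s : V) (L : List ℕ) : Prop := O.HasChild s (n - 1) ∧ ∀ x ∈ L, O.HasChild s x

open Classical in
variable (O) in
/-- The name of the class of the walks spelled by `word n e` which reach the center `s` after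
reading `L`. -/
noncomputable def zone (s : V) (e : ℕ) (L : List ℕ) : Option ℕ :=
  if O.Link s L then none else some e

variable (O) in
/-- The walk spelled by `word n e` starting at `z` reaches the center `s` after reading `L`. -/
def InArm (e : ℕ) (z s : V) (L : List ℕ) : Prop :=
  L ≠ [] ∧ (∃ L', word n e = L ++ L') ∧ 1 ≤ e ∧ e ≤ n ∧ O.DRead (inter L) z s ∧ O.cen s ∧
    O.typ z = 0 ∧ ∃ a, O.par a z ∧ O.typ a = n - 1

variable (O) in
/-- The vertex `t` belongs to the class `κ` of the center `s`. -/
def CenK (t s : V) (κ : Option ℕ) : Prop :=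
  O.cen s ∧ ((O.Bl t s ∧ κ = none) ∨
    ∃ e z L, O.Bl t z ∧ O.InArm e z s L ∧ κ = O.zone s e L)

theorem dread_cons {L : List ℕ} {z s : V} (hL : L ≠ []) (h : O.DRead (inter L) z s) :
    ∃ x L' a u, L = x :: L' ∧ O.par z a ∧ O.typ a = x ∧ O.par a u ∧ O.DRead (inter L') u s := by
  cases L with
  | nil => exact absurd rfl hL
  | cons x L =>
    obtain ⟨a, h1, h2, u, h3, -, h4⟩ := h
    exact ⟨x, L, a, u, rfl, h1, h2, h3, h4⟩

theorem InArm.low {e : ℕ} {z s : V} {L : List ℕ} (hn : 3 ≤ n) (h : O.InArm e z s L) :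
    O.Low z := by
  obtain ⟨h1, ⟨L', h2⟩, -, -, h3, -⟩ := h
  obtain ⟨x, L, a, u, rfl, h4, h5, -⟩ := dread_cons h1 h3
  rintro v ⟨a', h6, h7, -⟩
  cases O.par_unique h4 h6
  have := mem_word hn (show x ∈ word n e by rw [h2]; simp)
  omega

theorem InArm.not_cen {e : ℕ} {z s : V} {L : List ℕ} (h : O.InArm e z s L) : ¬ O.cen z := by
  obtain ⟨h1, -, -, -, h3, -⟩ := h
  obtain ⟨x, L, a, u, rfl, h4, h5, -⟩ := dread_cons h1 h3
  exact O.cen_par h4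

theorem InArm.not_bl_cen {e : ℕ} {z s c : V} {L : List ℕ} (hn : 3 ≤ n) (h : O.InArm e z s L)
    (hb : O.Bl c z) : ¬ O.cen c := by
  intro hc
  cases (low_of_cen hc).eq (h.low hn) hb
  exact h.not_cen hc

theorem dread_prefix {A B : List ℕ} {z s s' : V} (hs : O.cen s) (h : O.DRead (inter A) z s)
    (h' : O.DRead (inter (A ++ B)) z s') : B = [] := by
  rw [inter_append] at h'
  obtain ⟨u, h1, h2⟩ := Rd.append.1 h'
  cases DRead.det h h1
  by_contra hB
  obtain ⟨x, L', a, w, -, h3, -⟩ := dread_cons hB h2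
  exact O.cen_par h3 hs

theorem InArm.unique {e e' : ℕ} {z s s' : V} {L L' : List ℕ} (hn : 3 ≤ n)
    (h : O.InArm e z s L) (h' : O.InArm e' z s' L') : e = e' ∧ s = s' ∧ L = L' := by
  obtain ⟨h1, ⟨M, h2⟩, h3, h4, h5, h6, -⟩ := h
  obtain ⟨h1', ⟨M', h2'⟩, h3', h4', h5', h6', -⟩ := h'
  have hee : e = e' := by
    obtain ⟨x, A, a, u, rfl, h7, h8, -⟩ := dread_cons h1 h5
    obtain ⟨x', A', a', u', rfl, h7', h8', -⟩ := dread_cons h1' h5'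
    cases O.par_unique h7 h7'
    obtain rfl := h8.symm.trans h8'
    exact word_head_inj hn h3 h4 h3' h4' h2 h2'
  subst hee
  have hL : L = L' := by
    rcases List.append_eq_append_iff.1 (h2.symm.trans h2') with ⟨B, rfl, -⟩ | ⟨B, rfl, -⟩
    · rw [dread_prefix h6 h5 h5', List.append_nil]
    · rw [dread_prefix h6' h5' h5, List.append_nil]
  subst hL
  exact ⟨rfl, DRead.det h5 h5', rfl⟩

theorem CenK.unique {t s s' : V} {κ κ' : Option ℕ} (hn : 3 ≤ n) (h : O.CenK t s κ)
    (h' : O.CenK t s' κ') : s = s' ∧ κ = κ' := by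
  obtain ⟨hs, ⟨h1, h2⟩ | ⟨e, z, L, h1, h2, h3⟩⟩ := h <;>
    obtain ⟨hs', ⟨h1', h2'⟩ | ⟨e', z', L', h1', h2', h3'⟩⟩ := h'
  · exact ⟨(low_of_cen hs).eq (low_of_cen hs') (h1.symm.trans h1'), h2.trans h2'.symm⟩
  · exact (h2'.not_bl_cen hn (h1.symm.trans h1') hs).elim
  · exact (h2.not_bl_cen hn (h1'.symm.trans h1) hs').elim
  · cases (h2.low hn).eq (h2'.low hn) (h1.symm.trans h1')
    obtain ⟨rfl, rfl, rfl⟩ := h2.unique hn h2'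
    exact ⟨rfl, h3.trans h3'.symm⟩

theorem CenK.of_bl {t u s : V} {κ : Option ℕ} (hb : O.Bl u t) (h : O.CenK t s κ) :
    O.CenK u s κ := by
  obtain ⟨hs, ⟨h1, h2⟩ | ⟨e, z, L, h1, h2, h3⟩⟩ := h
  · exact ⟨hs, .inl ⟨hb.trans h1, h2⟩⟩
  · exact ⟨hs, .inr ⟨e, z, L, hb.trans h1, h2, h3⟩⟩

/-! ### The derived structure -/

/-- The vertices of the derived structure. -/
inductive _root_.SimpleOd.DV (V : Type) : Type
  | blk (B : Set V)
  | ctr (s : V) (κ : Option ℕ)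
  | fin (q : V) (τ : ℕ)

open Classical in
variable (O) in
/-- The derived vertex given by a vertex over `v_0`. -/
noncomputable def cls (t : V) : DV V :=
  if h : ∃ p : V × Option ℕ, O.CenK t p.1 p.2 then .ctr h.choose.1 h.choose.2
  else .blk {u | O.Bl t u}

theorem cls_eq_ctr {t s : V} {κ : Option ℕ} (hn : 3 ≤ n) (h : O.CenK t s κ) :
    O.cls t = .ctr s κ := by
  have h' : ∃ p : V × Option ℕ, O.CenK t p.1 p.2 := ⟨(s, κ), h⟩
  obtain ⟨h1, h2⟩ := h'.choose_spec.unique hn h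
  rw [cls, dif_pos h', h1, h2]

theorem cls_cases (t : V) : (∃ s κ, O.CenK t s κ ∧ O.cls t = .ctr s κ) ∨
    ((∀ s κ, ¬ O.CenK t s κ) ∧ O.cls t = .blk {u | O.Bl t u}) := by
  by_cases h : ∃ p : V × Option ℕ, O.CenK t p.1 p.2
  · exact .inl ⟨_, _, h.choose_spec, by rw [cls, dif_pos h]⟩
  · exact .inr ⟨fun s κ h' => h ⟨(s, κ), h'⟩, by rw [cls, dif_neg h]⟩

theorem cenK_of_cls {t s : V} {κ : Option ℕ} (h : O.cls t = .ctr s κ) : O.CenK t s κ := by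
  rcases O.cls_cases t with ⟨s', κ', h1, h2⟩ | ⟨-, h2⟩
  · rw [h2] at h; cases h; exact h1
  · rw [h2] at h; cases h

theorem cls_eq_of_bl {t u : V} (hn : 3 ≤ n) (h : O.Bl t u) : O.cls t = O.cls u := by
  rcases O.cls_cases u with ⟨s, κ, h1, h2⟩ | ⟨h1, h2⟩
  · rw [h2, cls_eq_ctr hn (h1.of_bl h)]
  · rcases O.cls_cases t with ⟨s, κ, h3, -⟩ | ⟨-, h4⟩
    · exact absurd (h3.of_bl h.symm) (h1 s κ)
    · rw [h2, h4]
      congr 1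
      ext v
      exact ⟨fun h' => h.symm.trans h', fun h' => h.trans h'⟩

theorem cls_ne_fin {t q : V} {τ : ℕ} : O.cls t ≠ .fin q τ := by
  rcases O.cls_cases t with ⟨s, κ, -, h⟩ | ⟨-, h⟩ <;> rw [h] <;> exact nofun

theorem bl_of_cls_eq {t u : V} (h : O.cls t = O.cls u) (ht : ∀ s κ, ¬ O.CenK t s κ) :
    O.Bl t u := by
  rcases O.cls_cases t with ⟨s, κ, h1, -⟩ | ⟨-, h2⟩
  · exact absurd h1 (ht s κ)
  rcases O.cls_cases u with ⟨s, κ, -, h3⟩ | ⟨-, h3⟩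
  · rw [h2, h3] at h; cases h
  · rw [h2, h3] at h
    simp only [DV.blk.injEq] at h
    have hu : u ∈ {v | O.Bl u v} := Bl.refl u
    rwa [← h] at hu

theorem rtg_arm_eq {t u : V} (ht : ∀ c, O.Bl t c → ¬ O.cen c)
    (h : Relation.ReflTransGen O.Jd t u) : O.arm t = O.arm u := by
  induction h with
  | refl => rfl
  | tail h1 h2 ih => rw [ih, h2.arm_eq (ht _ ⟨_, h1.tail h2, .refl⟩)]

theorem bl_arm_eq {t u : V} (ht : ∀ c, O.Bl t c → ¬ O.cen c) (h : O.Bl t u) :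
    O.arm t = O.arm u := by
  obtain ⟨c, h1, h2⟩ := id h
  rw [rtg_arm_eq ht h1, rtg_arm_eq (fun c h' => ht c (h.trans h')) h2]

theorem not_cen_of_not_cenK {t : V} (ht : ∀ s κ, ¬ O.CenK t s κ) (c : V) (h : O.Bl t c) :
    ¬ O.cen c := fun hc => ht c none ⟨hc, .inl ⟨h, rfl⟩⟩

variable (O) in
/-- Walks away from the center spelled by `full n e`. -/
def Up (e : ℕ) (z q : V) : Prop :=
  1 ≤ e ∧ e ≤ n ∧ O.typ z = 0 ∧ O.URead (full n e) z q ∧ (e = n - 2 ∨ ¬ O.cen z)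

variable (O) in
/-- The parts of walks spelled by `full n e` after passing through a center. -/
def Thru (e : ℕ) (L M : List ℕ) (s q : V) : Prop :=
  1 ≤ e ∧ e ≤ n ∧ e ≠ n - 2 ∧ word n e = L ++ M ∧ O.cen s ∧ O.URead (inter M ++ suf n e) s q

variable (O) in
/-- Walks towards the center spelled by `full n e`. -/
def Down (e : ℕ) (z q : V) : Prop :=
  1 ≤ e ∧ e ≤ n ∧ O.typ z = 0 ∧ O.DRead (full n e) z q

variable (O) in
/-- The parent relation of the derived structure. -/
inductive DPar (a b : DV V) : Prop
  | up (e : ℕ) (z q : V) (h : O.Up e z q) (ha : a = .fin q e) (hb : b = O.cls z)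
  | thru (e : ℕ) (L M : List ℕ) (s q : V) (h : O.Thru e L M s q) (ha : a = .fin q e)
      (hb : b = .ctr s (O.zone s e L))
  | down (e : ℕ) (z q : V) (h : O.Down e z q) (ha : a = O.cls z) (hb : b = .fin q e)
  | outer (e : ℕ) (q r : V) (he : e = n - 1 ∨ e = n) (hq : O.typ q = n) (hr : O.typ r = n + 2)
      (h : O.par r q) (ha : a = .fin r (e + 2)) (hb : b = .fin q e)
  | inner (e : ℕ) (q r : V) (he : e = n - 1 ∨ e = n) (hq : O.typ q = n) (hr : O.typ r = n + 2)
      (h : O.par q r) (ha : a = .fin q e) (hb : b = .fin r (e + 2))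

/-- Labels of derived vertices. -/
def _root_.SimpleOd.DV.typ : DV V → ℕ
  | .fin _ τ => τ
  | _ => 0

/-- Centers of the derived structure. -/
def _root_.SimpleOd.DV.cen : DV V → Prop
  | .ctr _ _ => True
  | _ => False

open Classical in
variable (O) in
/-- Arms of derived vertices. -/
noncomputable def dArm : DV V → ℕ
  | .fin q _ => O.arm q
  | .blk B => if h : B.Nonempty then O.arm h.choose else 0
  | .ctr _ _ => 0

theorem dArm_cls {t : V} (ht : ∀ s κ, ¬ O.CenK t s κ) : O.dArm (O.cls t) = O.arm t := by
  rcases O.cls_cases t with ⟨s, κ, h1, -⟩ | ⟨-, h2⟩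
  · exact absurd h1 (ht s κ)
  · have hne : {u | O.Bl t u}.Nonempty := ⟨t, Bl.refl t⟩
    rw [h2, dArm, dif_pos hne]
    exact (bl_arm_eq (not_cen_of_not_cenK ht) hne.choose_spec).symm

theorem not_cenK_of_not_cen {t : V} (ht : ¬ (O.cls t).cen) (s : V) (κ : Option ℕ) :
    ¬ O.CenK t s κ := by
  rcases O.cls_cases t with ⟨s', κ', -, h⟩ | ⟨h, -⟩
  · rw [h] at ht; exact absurd trivial ht
  · exact h s κ

theorem suf_last (hn : 3 ≤ n) (e : ℕ) : ∃ l x, suf n e = l ++ [x] ∧ x ≠ 0 := by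
  unfold suf
  split_ifs
  · exact ⟨[n], n + 2, rfl, by omega⟩
  · exact ⟨[], n, rfl, by omega⟩

theorem full_last (hn : 3 ≤ n) (e : ℕ) : ∃ l x, full n e = l ++ [x] ∧ x ≠ 0 := by
  unfold full
  split_ifs
  · exact ⟨[n - 1], n + 1, rfl, by omega⟩
  · obtain ⟨l, x, h, hx⟩ := suf_last hn e
    exact ⟨_, x, by rw [h, ← List.append_assoc], hx⟩

theorem full_of_ge (hn : 3 ≤ n) {e : ℕ} (he : e = n - 1 ∨ e = n) :
    full n e = inter (word n e) ++ [n] := by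
  rw [full, if_neg (by omega), suf, if_neg (by omega)]

theorem Down.not_cen (hn : 3 ≤ n) {e : ℕ} {z q : V} (h : O.Down e z q) : ¬ O.cen q := by
  obtain ⟨-, -, -, h⟩ := h
  obtain ⟨l, x, hl, hx⟩ := full_last hn e
  rw [hl] at h
  obtain ⟨u, -, h2⟩ := Rd.append.1 h
  exact not_cen_of_typ (by rw [(Rd.singleton.1 h2).2]; exact hx)

theorem Down.has_par (hn : 3 ≤ n) {e : ℕ} {z q : V} (h : O.Down e z q) :
    ∃ a l, O.par z a ∧ full n e = O.typ a :: l := by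
  obtain ⟨-, -, -, h⟩ := h
  obtain ⟨x, l, hx, -⟩ := full_cons hn e
  rw [hx] at h
  obtain ⟨u, h1, rfl, -⟩ := h
  exact ⟨u, l, h1, hx⟩

theorem Down.not_cenK (hn : 3 ≤ n) {e : ℕ} {z q : V} (h : O.Down e z q) (s : V)
    (κ : Option ℕ) : ¬ O.CenK z s κ := by
  obtain ⟨a, l, ha, hl⟩ := h.has_par hn
  have hlow : O.Low z := DRead.low hn h.2.2.2
  rintro ⟨hs, ⟨h1, -⟩ | ⟨e', z', L, h1, h2, -⟩⟩
  · cases hlow.eq (low_of_cen hs) h1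
    exact O.cen_par ha hs
  · cases hlow.eq (h2.low hn) h1
    obtain ⟨h3, ⟨M, h4⟩, h5, h6, h7, -⟩ := h2
    obtain ⟨he, hen, -, hd⟩ := h
    have hee : e' = e := by
      obtain ⟨x, L, a', u, rfl, h8, h9, -⟩ := dread_cons h3 h7
      cases O.par_unique ha h8
      refine full_head_inj hn h5 h6 he hen ?_ hl (L := 0 :: inter (L ++ M) ++ suf n e')
      have : e' ≠ n - 2 := by
        rintro rfl
        simp [word] at h4
      rw [full, if_neg this, h4, h9]
      rfl
    subst hee
    have : e' ≠ n - 2 := by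
      rintro rfl
      simp [word] at h4
      exact h3 h4.1
    rw [full, if_neg this, h4, inter_append, List.append_assoc] at hd
    obtain ⟨u, h8, h9⟩ := Rd.append.1 hd
    cases DRead.det h7 h8
    obtain ⟨x, l', hx⟩ : ∃ x l', inter M ++ suf n e' = x :: l' := by
      refine List.exists_cons_of_ne_nil ?_
      obtain ⟨l, x, hl, -⟩ := suf_last hn e'
      rw [hl]; simp
    rw [hx] at h9
    obtain ⟨w, h10, -⟩ := h9
    exact O.cen_par h10 hs

theorem up_thru {e : ℕ} {L M : List ℕ} {z s q : V} (h : O.Up e z q) (h' : O.Thru e L M s q) :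
    False := by
  obtain ⟨-, -, -, hu, hz⟩ := h
  obtain ⟨-, -, he, hw, hs, hu'⟩ := h'
  rw [full, if_neg he, hw, inter_append, List.append_assoc] at hu
  obtain ⟨u, h1, h2⟩ := Rd.append.1 hu
  cases URead.rev_det h2 hu'
  cases L with
  | nil => cases h1; exact hz.elim he fun h => h hs
  | cons x L => exact URead.not_cen (by simp [inter_cons]) h1 hs

theorem thru_aux {e : ℕ} {L M A : List ℕ} {s s' q : V} (h : O.Thru e L (A ++ M) s q)
    (h' : O.Thru e (L ++ A) M s' q) : A = [] ∧ s = s' := by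
  obtain ⟨-, -, -, -, -, hu⟩ := h
  obtain ⟨-, -, -, -, hs, hu'⟩ := h'
  rw [inter_append, List.append_assoc] at hu
  obtain ⟨u, h1, h2⟩ := Rd.append.1 hu
  cases URead.rev_det h2 hu'
  cases A with
  | nil => cases h1; exact ⟨rfl, rfl⟩
  | cons x L => exact (URead.not_cen (by simp [inter_cons]) h1 hs).elim

theorem thru_thru {e : ℕ} {L M L' M' : List ℕ} {s s' q : V} (h : O.Thru e L M s q)
    (h' : O.Thru e L' M' s' q) : L = L' ∧ s = s' := by
  have h1 := h.2.2.2.1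
  have h2 := h'.2.2.2.1
  rcases List.append_eq_append_iff.1 (h1.symm.trans h2) with ⟨A, rfl, rfl⟩ | ⟨A, rfl, rfl⟩
  · obtain ⟨rfl, rfl⟩ := thru_aux h h'
    exact ⟨by simp, rfl⟩
  · obtain ⟨rfl, rfl⟩ := thru_aux h' h
    exact ⟨by simp, rfl⟩

theorem up_last {e : ℕ} {z q : V} (hn : 3 ≤ n) (he : e = n - 1 ∨ e = n) (h : O.Up e z q) :
    ∃ y, O.par q y ∧ O.typ y = 0 := by
  obtain ⟨-, -, hz, h, -⟩ := h
  rw [full_of_ge hn he] at h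
  exact h.last hz

theorem thru_last {e : ℕ} {L M : List ℕ} {s q : V} (hn : 3 ≤ n) (he : e = n - 1 ∨ e = n)
    (h : O.Thru e L M s q) : ∃ y, O.par q y ∧ O.typ y = 0 := by
  obtain ⟨-, -, -, -, hs, h⟩ := h
  rw [suf, if_neg (by omega)] at h
  exact h.last (O.cen_typ hs)

theorem down_last {e : ℕ} {z q : V} (hn : 3 ≤ n) (he : e = n - 1 ∨ e = n) (h : O.Down e z q) :
    ∃ y, O.par y q ∧ O.typ y = 0 := by
  obtain ⟨-, -, hz, h⟩ := h
  rw [full_of_ge hn he] at h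
  exact h.last hz

theorem down_down {e e' : ℕ} {z z' q q' : V} (hn : 3 ≤ n) (h : O.Down e z q)
    (h' : O.Down e' z' q') (hz : O.cls z = O.cls z') : e = e' ∧ q = q' := by
  cases Low.eq (DRead.low hn h.2.2.2) (DRead.low hn h'.2.2.2) (bl_of_cls_eq hz (h.not_cenK hn))
  obtain ⟨a, l, h1, h2⟩ := h.has_par hn
  obtain ⟨a', l', h1', h2'⟩ := h'.has_par hn
  cases O.par_unique h1 h1'
  cases full_head_inj hn h.1 h.2.1 h'.1 h'.2.1 h2 h2'
  exact ⟨rfl, DRead.det h.2.2.2 h'.2.2.2⟩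

theorem dpar_unique (hn : 3 ≤ n) {a b b' : DV V} (h : O.DPar a b) (h' : O.DPar a b') :
    b = b' := by
  have ne0 : ∀ {q r : V}, O.typ r = n + 2 → (∃ y, O.par q y ∧ O.typ y = 0) → O.par q r →
      False := by
    rintro q r hr ⟨y, h1, h2⟩ h3
    cases O.par_unique h1 h3
    omega
  rcases h with ⟨e, z, q, h, rfl, rfl⟩ | ⟨e, L, M, s, q, h, rfl, rfl⟩ | ⟨e, z, q, h, rfl, rfl⟩ |
    ⟨e, q, r, he, hq, hr, h, rfl, rfl⟩ | ⟨e, q, r, he, hq, hr, h, rfl, rfl⟩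
  · rcases h' with ⟨e', z', q', h', ha, rfl⟩ | ⟨e', L', M', s', q', h', ha, rfl⟩ |
      ⟨e', z', q', h', ha, rfl⟩ | ⟨e', q', r', he', hq', hr', h', ha, rfl⟩ |
      ⟨e', q', r', he', hq', hr', h', ha, rfl⟩
    · cases ha
      rw [URead.rev_det h.2.2.2.1 h'.2.2.2.1]
    · cases ha; exact (up_thru h h').elim
    · exact absurd ha.symm cls_ne_fin
    · cases ha; have := h.2.1; omega
    · cases ha; exact (ne0 hr' (up_last hn he' h) h').elim
  · rcases h' with ⟨e', z', q', h', ha, rfl⟩ | ⟨e', L', M', s', q', h', ha, rfl⟩ |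
      ⟨e', z', q', h', ha, rfl⟩ | ⟨e', q', r', he', hq', hr', h', ha, rfl⟩ |
      ⟨e', q', r', he', hq', hr', h', ha, rfl⟩
    · cases ha; exact (up_thru h' h).elim
    · cases ha
      obtain ⟨rfl, rfl⟩ := thru_thru h h'
      rfl
    · exact absurd ha.symm cls_ne_fin
    · cases ha; have := h.2.1; omega
    · cases ha; exact (ne0 hr' (thru_last hn he' h) h').elim
  · rcases h' with ⟨e', z', q', h', ha, rfl⟩ | ⟨e', L', M', s', q', h', ha, rfl⟩ |
      ⟨e', z', q', h', ha, rfl⟩ | ⟨e', q', r', he', hq', hr', h', ha, rfl⟩ |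
      ⟨e', q', r', he', hq', hr', h', ha, rfl⟩
    · exact absurd ha cls_ne_fin
    · exact absurd ha cls_ne_fin
    · obtain ⟨rfl, rfl⟩ := down_down hn h h' ha
      rfl
    · exact absurd ha cls_ne_fin
    · exact absurd ha cls_ne_fin
  · rcases h' with ⟨e', z', q', h', ha, rfl⟩ | ⟨e', L', M', s', q', h', ha, rfl⟩ |
      ⟨e', z', q', h', ha, rfl⟩ | ⟨e', q', r', he', hq', hr', h', ha, rfl⟩ |
      ⟨e', q', r', he', hq', hr', h', ha, rfl⟩
    · cases ha; have := h'.2.1; omega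
    · cases ha; have := h'.2.1; omega
    · exact absurd ha.symm cls_ne_fin
    · simp only [DV.fin.injEq] at ha
      obtain ⟨rfl, h2⟩ := ha
      rw [O.par_unique h h', show e = e' by omega]
    · simp only [DV.fin.injEq] at ha
      omega
  · rcases h' with ⟨e', z', q', h', ha, rfl⟩ | ⟨e', L', M', s', q', h', ha, rfl⟩ |
      ⟨e', z', q', h', ha, rfl⟩ | ⟨e', q', r', he', hq', hr', h', ha, rfl⟩ |
      ⟨e', q', r', he', hq', hr', h', ha, rfl⟩
    · cases ha; exact (ne0 hr (up_last hn he h') h).elim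
    · cases ha; exact (ne0 hr (thru_last hn he h') h).elim
    · exact absurd ha.symm cls_ne_fin
    · simp only [DV.fin.injEq] at ha
      omega
    · cases ha
      rw [O.par_unique h h']

theorem dchild_unique (hn : 3 ≤ n) {a a' b : DV V} (h : O.DPar a b) (h' : O.DPar a' b)
    (hb : ¬ b.cen) : a = a' := by
  have ne0 : ∀ {q r : V}, O.typ q = n → O.typ r = n + 2 → (∃ y, O.par y q ∧ O.typ y = 0) →
      O.par r q → False := by
    rintro q r hq hr ⟨y, h1, h2⟩ h3
    cases O.child_unique h1 h3 (not_cen_of_typ (by omega))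
    omega
  rcases h with ⟨e, z, q, h, rfl, rfl⟩ | ⟨e, L, M, s, q, h, rfl, rfl⟩ | ⟨e, z, q, h, rfl, rfl⟩ |
    ⟨e, q, r, he, hq, hr, h, rfl, rfl⟩ | ⟨e, q, r, he, hq, hr, h, rfl, rfl⟩
  · rcases h' with ⟨e', z', q', h', rfl, ha⟩ | ⟨e', L', M', s', q', h', rfl, ha⟩ |
      ⟨e', z', q', h', rfl, ha⟩ | ⟨e', q', r', he', hq', hr', h', rfl, ha⟩ |
      ⟨e', q', r', he', hq', hr', h', rfl, ha⟩
    · have hK := not_cenK_of_not_cen hb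
      have hc := not_cen_of_not_cenK hK
      have hbl := bl_of_cls_eq ha hK
      obtain ⟨h1, h2, h3, h4, -⟩ := h
      obtain ⟨h1', h2', h3', h4', -⟩ := h'
      have harm : O.arm q = O.arm q' := by
        rw [h4.arm_eq (hc z (Bl.refl z)), h4'.arm_eq (hc z' hbl), bl_arm_eq hc hbl]
      obtain ⟨rfl, rfl⟩ := up_inj hn h1 h2 h1' h2' hbl h4 h4' harm
      rfl
    · rw [ha] at hb; exact absurd trivial hb
    · exact absurd ha cls_ne_fin
    · exact absurd ha cls_ne_fin
    · exact absurd ha cls_ne_fin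
  · exact absurd trivial hb
  · rcases h' with ⟨e', z', q', h', rfl, ha⟩ | ⟨e', L', M', s', q', h', rfl, ha⟩ |
      ⟨e', z', q', h', rfl, ha⟩ | ⟨e', q', r', he', hq', hr', h', rfl, ha⟩ |
      ⟨e', q', r', he', hq', hr', h', rfl, ha⟩
    · exact absurd ha.symm cls_ne_fin
    · cases ha
    · cases ha
      rw [DRead.rev_det (h.not_cen hn) h.2.2.2 h'.2.2.2]
    · cases ha
      exact (ne0 hq' hr' (down_last hn he' h) h').elim
    · cases ha; have := h.2.1; omega
  · rcases h' with ⟨e', z', q', h', rfl, ha⟩ | ⟨e', L', M', s', q', h', rfl, ha⟩ |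
      ⟨e', z', q', h', rfl, ha⟩ | ⟨e', q', r', he', hq', hr', h', rfl, ha⟩ |
      ⟨e', q', r', he', hq', hr', h', rfl, ha⟩
    · exact absurd ha.symm cls_ne_fin
    · cases ha
    · cases ha
      exact (ne0 hq hr (down_last hn he h') h).elim
    · cases ha
      rw [O.child_unique h h' (not_cen_of_typ (by omega))]
    · simp only [DV.fin.injEq] at ha
      omega
  · rcases h' with ⟨e', z', q', h', rfl, ha⟩ | ⟨e', L', M', s', q', h', rfl, ha⟩ |
      ⟨e', z', q', h', rfl, ha⟩ | ⟨e', q', r', he', hq', hr', h', rfl, ha⟩ |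
      ⟨e', q', r', he', hq', hr', h', rfl, ha⟩
    · exact absurd ha.symm cls_ne_fin
    · cases ha
    · cases ha; have := h'.2.1; omega
    · simp only [DV.fin.injEq] at ha
      omega
    · simp only [DV.fin.injEq] at ha
      obtain ⟨rfl, h2⟩ := ha
      rw [O.child_unique h h' (not_cen_of_typ (by omega)), show e = e' by omega]

theorem rtg_cen {z s : V} (hs : O.cen s)
    (h : Relation.ReflTransGen O.Jd z s) :
    z = s ∨ ∃ a, O.par a s ∧ O.typ a = n - 1 ∧ O.arm a = O.arm z := by
  induction h using Relation.ReflTransGen.head_induction_on with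
  | refl => exact .inl rfl
  | @head z v h1 h2 ih =>
    right
    by_cases hv : O.cen v
    · cases (low_of_cen hv).rtg_eq h2
      obtain ⟨a, h6, h7, h8, -⟩ := h1
      exact ⟨a, h8, h7, (O.arm_par h6 (O.cen_par h8)).symm⟩
    · rcases ih with rfl | ⟨a, h3, h4, h5⟩
      · exact absurd hs hv
      · exact ⟨a, h3, h4, by rw [h5, h1.arm_eq hv]⟩

/-- The beginning of the walk from a center to a vertex of its class, continued away from the
center. -/
theorem up_first {e : ℕ} {z q s : V} {κ : Option ℕ} (hn : 3 ≤ n) (h : O.Up e z q)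
    (hK : O.CenK z s κ) : ∃ M w a, O.URead (inter M ++ [n - 1]) s a ∧ O.par a w ∧
      O.arm a = O.arm q ∧ O.Bl z w ∧ ∀ x ∈ M, x ≤ n - 2 := by
  obtain ⟨h1, h2, h3, h4, h5⟩ := h
  obtain ⟨hs, ⟨h6, -⟩ | ⟨e', z', L, h6, h7, -⟩⟩ := hK
  · by_cases hz : O.cen z
    · cases (low_of_cen hz).eq (low_of_cen hs) h6
      obtain rfl := h5.resolve_right fun h => h hz
      rw [full, if_pos rfl] at h4
      obtain ⟨a, h8, h9, h10⟩ := h4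
      exact ⟨[], z, a, ⟨a, h8, h9, rfl⟩, h8, (URead.arm_eq (O.cen_par h8) h10).symm, h6, by simp⟩
    · obtain ⟨c, h8, h9⟩ := id h6
      cases (low_of_cen hs).rtg_eq h9
      rcases rtg_cen hs h8 with rfl | ⟨a, h10, h11, h12⟩
      · exact absurd hs hz
      · exact ⟨[], s, a, ⟨a, h10, h11, rfl⟩, h10, by rw [h12, h4.arm_eq hz], h6, by simp⟩
  · have hc : ∀ c, O.Bl z c → ¬ O.cen c := fun c hc => h7.not_bl_cen hn (hc.symm.trans h6)
    obtain ⟨-, ⟨L', hL⟩, -, -, h8, -, h9, a, h10, h11⟩ := h7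
    refine ⟨L.reverse, z', a, Rd.append.2 ⟨z', h8.reverse h9, a, h10, h11, rfl⟩, h10, ?_, h6, ?_⟩
    · rw [O.arm_par h10 (hc z' h6), ← bl_arm_eq hc h6, h4.arm_eq (hc z (Bl.refl z))]
    · intro x hx
      exact (mem_word hn (show x ∈ word n e' by rw [hL]; simp_all)).2

theorem thru_first {e : ℕ} {L M : List ℕ} {s q : V} (hn : 3 ≤ n) (h : O.Thru e L M s q) :
    ∃ y, O.URead (inter M ++ [n]) s y ∧ O.arm y = O.arm q ∧ ∀ x ∈ M, x ≤ n - 2 := by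
  obtain ⟨-, -, -, h4, -, h6⟩ := h
  have hM : ∀ x ∈ M, x ≤ n - 2 := fun x hx =>
    (mem_word hn (show x ∈ word n e by rw [h4]; simp [hx])).2
  unfold suf at h6
  split_ifs at h6 with hc
  · rw [show [n, n + 2] = [n] ++ [n + 2] from rfl, ← List.append_assoc] at h6
    obtain ⟨y, h7, h8⟩ := Rd.append.1 h6
    exact ⟨y, h7, (URead.arm_eq (URead.not_cen (by simp) h7) h8).symm, hM⟩
  · exact ⟨q, h6, rfl, hM⟩

theorem darm_inj_thru {e e' : ℕ} {L M L' M' : List ℕ} {s q q' : V} (hn : 3 ≤ n)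
    (h : O.Thru e L M s q) (h' : O.Thru e' L' M' s q') (hz : O.zone s e L = O.zone s e' L')
    (ha : O.arm q = O.arm q') : e = e' ∧ q = q' := by
  obtain ⟨y, h1, h2, h3⟩ := thru_first hn h
  obtain ⟨y', h1', h2', h3'⟩ := thru_first hn h'
  obtain ⟨rfl, -, rfl⟩ := URead.two_read h1 h1' (by omega)
    (fun h => by have := h3' _ h; omega) (fun h => by have := h3 _ h; omega)
  obtain ⟨he, hen, hne, hw, hs, hu⟩ := h
  obtain ⟨he', hen', hne', hw', -, hu'⟩ := h'
  have hee : e = e' := by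
    by_cases hM : M = []
    · subst hM
      rw [List.append_nil] at hw hw'
      have key : ∀ {e L}, word n e = L → e ≤ n → e ≠ n - 2 → O.Link s L → e = n - 1 := by
        rintro e L rfl hen hne ⟨hl1, hl2⟩
        by_contra hc
        refine O.not_full hn s fun x hx hxn => ?_
        have : O.HasChild s x := by
          by_cases hx1 : x = n
          · obtain ⟨h8, h9⟩ := Rd.singleton.1 h1
            exact ⟨y, h8, by omega⟩
          by_cases hx2 : x = n - 1
          · exact hx2 ▸ hl1
          · exact hl2 x (mem_word_of_ne hn (by tauto) hx (by omega))
        obtain ⟨b, hb, hbt⟩ := this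
        exact ⟨b, .inl hb, hbt⟩
      unfold zone at hz
      split_ifs at hz with hl hl'
      · rw [key hw hen hne hl, key hw' hen' hne' hl']
      · exact Option.some_injective _ hz
    · exact word_last_inj hn hM he hen he' hen' hw hw'
  subst hee
  exact ⟨rfl, hu.det hu' ha⟩

theorem darm_inj (hn : 3 ≤ n) {a a' b : DV V} (hb : b.cen) (h : O.DPar a b) (h' : O.DPar a' b)
    (ha : O.dArm a = O.dArm a') : a = a' := by
  obtain ⟨s, κ, rfl⟩ : ∃ s κ, b = .ctr s κ := by
    cases b with
    | ctr s κ => exact ⟨s, κ, rfl⟩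
    | _ => exact absurd hb id
  have mixed : ∀ {e e' z q q' L M}, O.Up e z q → O.CenK z s κ → O.Thru e' L M s q' →
      O.arm q = O.arm q' → False := by
    intro e e' z q q' L M h hK h' ha
    obtain ⟨M1, w, a, h1, h2, h3, h4, h5⟩ := up_first hn h hK
    obtain ⟨y, h6, h7, h8⟩ := thru_first hn h'
    obtain ⟨-, h9, -⟩ := URead.two_read h1 h6 (by omega)
      (fun h => by have := h8 _ h; omega) (fun h => by have := h5 _ h; omega)
    omega
  rcases h with ⟨e, z, q, h, rfl, hb⟩ | ⟨e, L, M, s, q, h, rfl, hb⟩ | ⟨e, z, q, h, rfl, hb⟩ |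
    ⟨e, q, r, he, hq, hr, h, rfl, hb⟩ | ⟨e, q, r, he, hq, hr, h, rfl, hb⟩ <;> try cases hb
  · have hK := cenK_of_cls hb.symm
    rcases h' with ⟨e', z', q', h', rfl, hb'⟩ | ⟨e', L', M', s', q', h', rfl, hb'⟩ |
      ⟨e', z', q', h', rfl, hb'⟩ | ⟨e', q', r', he', hq', hr', h', rfl, hb'⟩ |
      ⟨e', q', r', he', hq', hr', h', rfl, hb'⟩
    · have hK' := cenK_of_cls hb'.symm
      simp only [dArm] at ha
      obtain ⟨M1, w, a, h1, h2, h3, h4, h5⟩ := up_first hn h hK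
      obtain ⟨M1', w', a', h1', h2', h3', h4', h5'⟩ := up_first hn h' hK'
      obtain ⟨rfl, -, rfl⟩ := URead.two_read h1 h1' (by omega)
        (fun h => by have := h5' _ h; omega) (fun h => by have := h5 _ h; omega)
      cases O.par_unique h2 h2'
      obtain ⟨rfl, rfl⟩ := up_inj hn h.1 h.2.1 h'.1 h'.2.1 (h4.trans h4'.symm) h.2.2.2.1
        h'.2.2.2.1 ha
      rfl
    · cases hb'
      exact (mixed h hK h' ha).elim
    all_goals cases hb'
  · rcases h' with ⟨e', z', q', h', rfl, hb'⟩ | ⟨e', L', M', s', q', h', rfl, hb'⟩ |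
      ⟨e', z', q', h', rfl, hb'⟩ | ⟨e', q', r', he', hq', hr', h', rfl, hb'⟩ |
      ⟨e', q', r', he', hq', hr', h', rfl, hb'⟩
    · exact (mixed h' (cenK_of_cls hb'.symm) h ha.symm).elim
    · simp only [DV.ctr.injEq] at hb'
      obtain ⟨rfl, hz⟩ := hb'
      obtain ⟨rfl, rfl⟩ := darm_inj_thru hn h h' hz ha
      rfl
    all_goals cases hb'

theorem darm_par (hn : 3 ≤ n) {a b : DV V} (h : O.DPar a b) (hb : ¬ b.cen) :
    O.dArm a = O.dArm b := by
  rcases h with ⟨e, z, q, h, rfl, rfl⟩ | ⟨e, L, M, s, q, h, rfl, rfl⟩ | ⟨e, z, q, h, rfl, rfl⟩ |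
    ⟨e, q, r, he, hq, hr, h, rfl, rfl⟩ | ⟨e, q, r, he, hq, hr, h, rfl, rfl⟩
  · have hK := not_cenK_of_not_cen hb
    rw [dArm_cls hK]
    exact h.2.2.2.1.arm_eq (not_cen_of_not_cenK hK z (Bl.refl z))
  · exact absurd trivial hb
  · rw [dArm_cls (h.not_cenK hn)]
    exact (DRead.arm_eq (h.not_cen hn) h.2.2.2).symm
  · exact O.arm_par h (not_cen_of_typ (by omega))
  · exact O.arm_par h (not_cen_of_typ (by omega))

theorem dcen_par (hn : 3 ≤ n) {a b : DV V} (h : O.DPar a b) : ¬ a.cen := by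
  rcases h with ⟨e, z, q, h, rfl, rfl⟩ | ⟨e, L, M, s, q, h, rfl, rfl⟩ | ⟨e, z, q, h, rfl, rfl⟩ |
    ⟨e, q, r, he, hq, hr, h, rfl, rfl⟩ | ⟨e, q, r, he, hq, hr, h, rfl, rfl⟩
  · exact id
  · exact id
  · rcases O.cls_cases z with ⟨s, κ, h1, -⟩ | ⟨-, h1⟩
    · exact absurd h1 (h.not_cenK hn s κ)
    · rw [h1]; exact id
  · exact id
  · exact id

variable (O) in
/-- The map to the derived structure. -/
noncomputable def lbl (τ : ℕ) (v : V) : DV V := if τ = 0 then O.cls v else .fin v τ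

variable (O) in
/-- The edges of the derived structure. -/
def DRel (e : ℕ) (x y : DV V) : Prop :=
  ∃ u v, Der n R e u v ∧ x = O.lbl (src n e) u ∧ y = O.lbl e v

theorem typ_lbl (τ : ℕ) (v : V) : (O.lbl τ v).typ = τ := by
  unfold lbl
  split_ifs with h
  · rcases O.cls_cases v with ⟨s, κ, -, h1⟩ | ⟨-, h1⟩ <;> rw [h1, h] <;> rfl
  · rfl

theorem link_append {s : V} {L M : List ℕ} (h : ∀ x ∈ M, O.HasChild s x) :
    O.Link s (L ++ M) ↔ O.Link s L := by
  simp only [Link, List.mem_append]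
  exact and_congr_right fun _ =>
    ⟨fun h' x hx => h' x (.inl hx), fun h' x hx => hx.elim (h' x) (h x)⟩

theorem zone_append {s : V} {e : ℕ} {L M : List ℕ} (h : ∀ x ∈ M, O.HasChild s x) :
    O.zone s e (L ++ M) = O.zone s e L := by
  by_cases hL : O.Link s L
  · rw [zone, zone, if_pos hL, if_pos ((link_append h).2 hL)]
  · rw [zone, zone, if_neg hL, if_neg fun h' => hL ((link_append h).1 h')]

theorem dpar_of_thru {e : ℕ} {L M : List ℕ} {s w y q : V} (hn : 3 ≤ n) (he : 1 ≤ e)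
    (hen : e ≤ n) (hne : e ≠ n - 2) (hw : word n e = L ++ M) (hs : O.cen s)
    (hp : Path R M s w) (hy : R n w y) (hq : if e < n - 2 then R (n + 2) y q else y = q) :
    O.DPar (.fin q e) (.ctr s (O.zone s e L)) := by
  have hM : ∀ x ∈ M, x < n := fun x hx => by
    have := mem_word hn (show x ∈ word n e by rw [hw]; simp [hx])
    omega
  have hnd : M.Nodup := ((hw ▸ word_nodup n e : (L ++ M).Nodup)).of_append_right
  obtain ⟨L2, L3, rfl, h2, h3⟩ := O.center_run hM hnd hs hp hy
  rw [← zone_append h2]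
  exact .thru e (L ++ L2) L3 s q ⟨he, hen, hne, by rw [hw, List.append_assoc], hs,
    up_tail hn (O.cen_typ hs) h3 hq⟩ rfl rfl

theorem dpar_of_der (hn : 3 ≤ n) {e : ℕ} {t q : V} (hen : e ≤ n) (h : Der n R e t q) :
    O.typ t = 0 ∧ (O.DPar (O.cls t) (.fin q e) ∨ O.DPar (.fin q e) (O.cls t)) := by
  obtain ⟨he, -, h⟩ := h
  rw [if_neg (by omega)] at h
  by_cases hne : e = n - 2
  · rw [if_pos hne] at h
    obtain ⟨a, ha, hq⟩ := h
    obtain ⟨ht, hat, hta⟩ := O.edge0 (by omega) ha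
    obtain ⟨-, -, -, hqt, haq⟩ := O.edge hq
    have hac : ¬ O.cen a := not_cen_of_typ (by omega)
    have hf : full n e = [n - 1, n + 1] := if_pos hne
    refine ⟨ht, ?_⟩
    rcases hta with hta | hta <;> rcases haq with haq | haq
    · refine .inl (.down e t q ⟨he, hen, ht, ?_⟩ rfl rfl)
      rw [hf]
      exact ⟨a, hta, hat, q, haq, hqt, rfl⟩
    · cases O.child_unique hta haq hac; omega
    · cases O.par_unique hta haq; omega
    · refine .inr (.up e t q ⟨he, hen, ht, ?_, .inl hne⟩ rfl rfl)
      rw [hf]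
      exact ⟨a, hta, hat, q, haq, hqt, rfl⟩
  rw [if_neg hne] at h
  obtain ⟨z, w, y, hz, hp, hy, hq⟩ := h
  have hf : full n e = inter (word n e) ++ suf n e := if_neg hne
  have hw : ∀ x ∈ word n e, x < n := fun x hx => by have := mem_word hn hx; omega
  have hw' : n - 1 ∉ word n e := fun hx => by have := mem_word hn hx; omega
  rw [cls_eq_of_bl hn (twin_bl hn hz)]
  obtain ⟨a, hta, hza⟩ := hz
  obtain ⟨ht, -, -⟩ := O.edge0 (by omega) hta
  obtain ⟨hz0, hat, hza⟩ := O.edge0 (by omega) hza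
  refine ⟨ht, ?_⟩
  by_cases hc : O.cen z
  · have hza := hza.resolve_left fun h => O.cen_par h hc
    have hL : O.Link z [] := ⟨⟨a, hza, hat⟩, by simp⟩
    have := O.dpar_of_thru hn he hen hne (L := []) rfl hc hp hy hq
    rw [zone, if_pos hL] at this
    rw [cls_eq_ctr hn ⟨hc, .inl ⟨Bl.refl z, rfl⟩⟩]
    exact .inr this
  rcases hza with hza | hza
  · refine .inr (.up e z q ⟨he, hen, hz0, ?_, .inr hc⟩ rfl rfl)
    rw [hf]
    exact up_tail hn hz0 (up_run hw (word_nodup n e) hza (by rwa [hat]) (by omega) hp hy) hq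
  · rcases down_run hw (word_nodup n e) hc hza (by rwa [hat]) (by omega) hp hy with
      h | ⟨L, M, s, h1, h2, h3, h4, h5⟩
    · refine .inl (.down e z q ⟨he, hen, hz0, ?_⟩ rfl rfl)
      rw [hf]
      exact down_tail hn hz0 h hq
    · have hin : O.InArm e z s L := ⟨h2, ⟨M, h1⟩, he, hen, h3, h4, hz0, a, hza, hat⟩
      rw [cls_eq_ctr hn ⟨h4, .inr ⟨e, z, L, Bl.refl z, hin, rfl⟩⟩]
      exact .inr (dpar_of_thru hn he hen hne h1 h4 h5 hy hq)

theorem dedge (hn : 3 ≤ n) {e : ℕ} {x y : DV V} (h : O.DRel e x y) :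
    1 ≤ e ∧ e ≤ n + 2 ∧ x.typ = src n e ∧ y.typ = e ∧ (O.DPar x y ∨ O.DPar y x) := by
  obtain ⟨u, v, h, rfl, rfl⟩ := h
  refine ⟨h.1, h.2.1, typ_lbl _ _, typ_lbl _ _, ?_⟩
  have he0 : e ≠ 0 := by have := h.1; omega
  by_cases hen : e ≤ n
  · rw [src_of_le hen, lbl, if_pos rfl, lbl, if_neg he0]
    exact (dpar_of_der hn hen h).2
  · obtain ⟨-, h2, h⟩ := h
    rw [if_pos (by omega)] at h
    obtain ⟨-, -, hu, hv, h⟩ := O.edge h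
    have hsrc : src n (n + 2) = n := by simp [src]
    rw [hsrc] at hu
    obtain ⟨e', rfl⟩ : ∃ e', e = e' + 2 := ⟨e - 2, by omega⟩
    have hsrc' : src n (e' + 2) = e' := by unfold src; split_ifs <;> omega
    rw [hsrc', lbl, if_neg (by omega), lbl, if_neg he0]
    have he' : e' = n - 1 ∨ e' = n := by omega
    rcases h with h | h
    · exact .inl (.inner e' u v he' hu hv h rfl rfl)
    · exact .inr (.outer e' u v he' hu hv h rfl rfl)

variable (O) in
/-- The derived simple-od structure. -/
noncomputable def derive (hn : 3 ≤ n) : OdStr n O.DRel where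
  typ := DV.typ
  cen := DV.cen
  par := O.DPar
  arm := O.dArm
  edge := dedge hn
  par_unique := dpar_unique hn
  child_unique := dchild_unique hn
  arm_inj hb h h' := darm_inj hn hb h h'
  arm_par := darm_par hn
  cen_par := dcen_par hn
  cen_typ {v} hv := by
    cases v with
    | ctr s κ => rfl
    | _ => exact absurd hv id
  arm_lt v := by
    cases v with
    | ctr s κ => exact (show 0 < n - 1 by omega)
    | fin q τ => exact O.arm_lt q
    | blk B =>
      by_cases hB : B.Nonempty
      · rw [dArm, dif_pos hB]
        exact O.arm_lt _
      · rw [dArm, dif_neg hB]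
        omega

theorem isHom_lbl : IsHom n (Der n R) O.DRel O.lbl := fun _ u v h => ⟨u, v, h, rfl, rfl⟩

end OdStr

/-- No vertex of a simple-od with fewer than `n` arms admits all walks spelled by the images of
the edges `⟨v_0, v_1⟩, …, ⟨v_0, v_n⟩` under an iterate of `φ`. -/
theorem not_iterate_der {n : ℕ} (hn : 3 ≤ n) (m : ℕ) : ∀ {V : Type} {R : ℕ → V → V → Prop}
    (_ : OdStr n R) (t : V), (∀ e, 1 ≤ e → e ≤ n → ∃ q, (Der n)^[m] R e t q) → False := by
  induction m with
  | zero =>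
    intro V R O t h
    refine O.not_full hn t fun e he hen => ?_
    obtain ⟨q, hq⟩ := h e he hen
    obtain ⟨-, -, -, h1, h2⟩ := O.edge hq
    exact ⟨q, h2.symm, h1⟩
  | succ m ih =>
    intro V R O t h
    obtain ⟨π, hπ⟩ := (O.isHom_lbl).iterate hn m
    refine ih (O.derive hn) (π 0 t) fun e he hen => ?_
    obtain ⟨q, hq⟩ := h e he hen
    have := hπ e t q hq
    rw [src_of_le hen] at this
    exact ⟨_, this⟩
/-! ### The map `f` on the edges of `X_1` -/

noncomputable section

/-- The oriented segment of `S` from `v_x` to `v_y`, for adjacent vertices. -/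
def segPt (n x y : ℕ) (s : ℝ) : Sspace n :=
  ⟨embC n (interpC (vcoord n x) (vcoord n y) s), Set.mem_range_self _⟩

/-- The `e`-th edge of `X_0`, parametrized from `v_{src e}` to `v_e`. -/
def edgePt (n e : ℕ) : ℝ → Sspace n := segPt n (src n e) e

end

theorem embC_norm (n : ℕ) (p : ℕ × ℝ) : ‖embC n p‖ = min 1 (max 0 p.2) := by
  have h : (2 * Real.pi * Complex.I * (p.1 : ℂ) / (n : ℂ)) =
      ((2 * Real.pi * p.1 / n : ℝ) : ℂ) * Complex.I := by push_cast; ring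
  rw [embC, norm_mul, h, Complex.norm_exp_ofReal_mul_I, mul_one, Complex.norm_real,
    Real.norm_of_nonneg]
  exact le_min zero_le_one (le_max_left _ _)

theorem embC_inj {n : ℕ} (hn : n ≠ 0) {p q : ℕ × ℝ} (hq : 0 < q.2) (h : embC n p = embC n q) :
    p.1 % n = q.1 % n ∧ min 1 (max 0 p.2) = min 1 (max 0 q.2) := by
  have h2 : min 1 (max 0 p.2) = min 1 (max 0 q.2) := by
    rw [← embC_norm n p, ← embC_norm n q, h]
  refine ⟨?_, h2⟩
  have hpos : 0 < min 1 (max 0 q.2) := lt_min one_pos (lt_max_of_lt_right hq)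
  rw [embC, embC, h2] at h
  have h3 := mul_left_cancel₀ (by exact_mod_cast hpos.ne') h
  rw [Complex.exp_eq_exp_iff_exists_int] at h3
  obtain ⟨k, hk⟩ := h3
  have hn' : (n : ℂ) ≠ 0 := by exact_mod_cast hn
  have hpi : (2 * Real.pi * Complex.I : ℂ) ≠ 0 := Complex.two_pi_I_ne_zero
  have h4 : (p.1 : ℂ) = q.1 + k * n := by
    field_simp at hk
    have : (2 * Real.pi * Complex.I : ℂ) * p.1 = (2 * Real.pi * Complex.I) * (q.1 + k * n) := by
      linear_combination (2 * Real.pi * Complex.I : ℂ) * hk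
    exact mul_left_cancel₀ hpi this
  have h5 : (p.1 : ℤ) = q.1 + k * n := by exact_mod_cast h4
  have h6 : (p.1 : ℤ) % n = (q.1 : ℤ) % n := by
    rw [h5, Int.add_mul_emod_self_right]
  exact_mod_cast h6

theorem fS_embC {n : ℕ} (hn : n ≠ 0) {p : ℕ × ℝ} (hp : 0 < p.2)
    (h : embC n p ∈ Sset n) : (fS n ⟨embC n p, h⟩ : ℂ) = embC n (Gmap n p) := by
  have h1 : embC n (Function.invFun (embC n) (embC n p)) = embC n p :=
    Function.invFun_eq ⟨p, rfl⟩
  obtain ⟨h2, h3⟩ := embC_inj hn hp h1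
  show embC n (Gmap n (Function.invFun (embC n) (embC n p))) = _
  rw [Gmap, Gmap, h2, h3]

theorem fS_segPt {n e a j x y : ℕ} {r t s : ℝ} (ha : a < n)
    (hc : interpC (vcoord n (src n e)) (vcoord n e) r = (a, t)) (ht : 0 < t) (ht1 : t < 1)
    (hseg : segOf n (a + 1) t = (j, s)) (hx : imgCoord n (a + 1) j = vcoord n x)
    (hy : imgCoord n (a + 1) (j + 1) = vcoord n y) :
    fS n (edgePt n e r) = segPt n x y s := by
  have hp : 0 < (interpC (vcoord n (src n e)) (vcoord n e) r).2 := by rw [hc]; exact ht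
  refine Subtype.ext ((fS_embC (by omega) hp _).trans ?_)
  have hclamp : min 1 (max 0 t) = t := by rw [max_eq_right ht.le, min_eq_right ht1.le]
  rw [hc, Gmap]
  simp only [Nat.mod_eq_of_lt ha, hclamp, hseg, hx, hy]
  rfl

theorem vcoord_zero (n : ℕ) : vcoord n 0 = (0, 0) := if_pos rfl

theorem vcoord_low {n e : ℕ} (h : 1 ≤ e) (h' : e ≤ n - 2) : vcoord n e = (e - 1, 1) := by
  rw [vcoord, if_neg (by omega), if_pos h']

theorem vcoord_sub_one {n : ℕ} (hn : 3 ≤ n) : vcoord n (n - 1) = (n - 2, 1 / 2) := by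
  rw [vcoord, if_neg (by omega), if_neg (by omega), if_pos rfl]

theorem vcoord_self {n : ℕ} (hn : 3 ≤ n) : vcoord n n = (n - 1, 1 / 2) := by
  rw [vcoord, if_neg (by omega), if_neg (by omega), if_neg (by omega), if_pos rfl]

theorem vcoord_add_one {n : ℕ} (hn : 3 ≤ n) : vcoord n (n + 1) = (n - 2, 1) := by
  rw [vcoord, if_neg (by omega), if_neg (by omega), if_neg (by omega), if_neg (by omega),
    if_pos rfl]

theorem vcoord_add_two {n : ℕ} (hn : 3 ≤ n) : vcoord n (n + 2) = (n - 1, 1) := by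
  rw [vcoord, if_neg (by omega), if_neg (by omega), if_neg (by omega), if_neg (by omega),
    if_neg (by omega)]

theorem segPt_rev {n e : ℕ} (hn : 3 ≤ n) (h1 : 1 ≤ e) (s : ℝ) :
    segPt n e (src n e) s = edgePt n e (1 - s) := by
  refine Subtype.ext (congrArg (embC n) ?_)
  have h : src n e = 0 ∨ (src n e = n - 1 ∧ e = n + 1) ∨ (src n e = n ∧ e = n + 2) := by
    unfold src; split_ifs <;> omega
  rcases h with h | ⟨h, rfl⟩ | ⟨h, rfl⟩
  · rw [h]
    have : (vcoord n e).2 ≠ 0 := by unfold vcoord; split_ifs <;> first | omega | norm_num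
    simp [interpC, this, vcoord_zero]
  · rw [h]
    rw [vcoord_sub_one hn, vcoord_add_one hn]
    simp [interpC]
    ring
  · rw [h]
    rw [vcoord_self hn, vcoord_add_two hn]
    simp [interpC]
    ring

/-- `f` maps the part of the `e`-th edge of `X_0` between the parameters `c` and `d` affinely
onto the segment from `v_x` to `v_y`. -/
def Seg (n e x y : ℕ) (c d : ℝ) : Prop :=
  ∀ s ∈ Set.Ioo (0 : ℝ) 1, c + (d - c) * s ∈ Set.Ioo (0 : ℝ) 1 ∧
    fS n (edgePt n e (c + (d - c) * s)) = segPt n x y s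

theorem Seg.rev {n e e' : ℕ} {c d : ℝ} (hn : 3 ≤ n) (h1 : 1 ≤ e')
    (h : Seg n e e' (src n e') c d) : Seg n e (src n e') e' d c := fun s hs => by
  have := h (1 - s) ⟨by linarith [hs.2], by linarith [hs.1]⟩
  rw [segPt_rev hn h1, sub_sub_cancel] at this
  rwa [show d + (c - d) * s = c + (d - c) * (1 - s) by ring]

theorem floor_add {j : ℕ} {s : ℝ} (hs : s ∈ Set.Ioo (0 : ℝ) 1) : ⌊(j : ℝ) + s⌋₊ = j := by
  rw [Nat.floor_eq_iff (by have := hs.1; positivity)]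
  exact ⟨by linarith [hs.1], by linarith [hs.2]⟩

theorem seg_low {n e j x y : ℕ} (he : 1 ≤ e) (hen : e ≤ n - 3) (hj : j ≤ 2 * n - 1)
    (hx : imgCoord n e j = vcoord n x) (hy : imgCoord n e (j + 1) = vcoord n y) :
    Seg n e x y (j / (2 * n)) ((j + 1) / (2 * n)) := fun s hs => by
  have hn : (0 : ℝ) < 2 * n := by have : 0 < n := by omega
                                  positivity
  have hr : (j : ℝ) / (2 * n) + ((j + 1) / (2 * n) - j / (2 * n)) * s = (j + s) / (2 * n) := by
    field_simp; ring
  have hjn : (j : ℝ) + 1 ≤ 2 * n := by exact_mod_cast (show j + 1 ≤ 2 * n by omega)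
  have hm : 2 * (n : ℝ) * ((j + s) / (2 * n)) = j + s := mul_div_cancel₀ _ hn.ne'
  have hj0 : (0 : ℝ) ≤ j := j.cast_nonneg
  obtain ⟨a, rfl⟩ : ∃ a, e = a + 1 := ⟨e - 1, by omega⟩
  refine ⟨hr ▸ ⟨by have := hs.1; positivity, (div_lt_one hn).2 (by linarith [hs.2])⟩, ?_⟩
  refine fS_segPt (a := a) (t := (j + s) / (2 * n)) (by omega) ?_ (by have := hs.1; positivity)
    ((div_lt_one hn).2 (by linarith [hs.2])) ?_ hx hy
  · rw [hr, src_of_le (by omega), vcoord_zero, vcoord_low he (by omega)]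
    simp [interpC]
  · rw [segOf, if_neg (by omega), if_neg (by omega), if_neg (by omega), hm, floor_add hs,
      min_eq_right hj, add_sub_cancel_left]

theorem seg_sub_two {n j x y : ℕ} (hn : 3 ≤ n) (hj : j ≤ 1)
    (hx : imgCoord n (n - 2) j = vcoord n x) (hy : imgCoord n (n - 2) (j + 1) = vcoord n y) :
    Seg n (n - 2) x y (j / 2) ((j + 1) / 2) := fun s hs => by
  have hr : (j : ℝ) / 2 + ((j + 1) / 2 - j / 2) * s = (j + s) / 2 := by ring
  have hjn : (j : ℝ) ≤ 1 := by exact_mod_cast hj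
  have hm : 2 * (((j : ℝ) + s) / 2) = j + s := by ring
  have hj0 : (0 : ℝ) ≤ j := j.cast_nonneg
  have ha : n - 3 + 1 = n - 2 := by omega
  refine ⟨hr ▸ ⟨by linarith [hs.1], by linarith [hs.2]⟩, ?_⟩
  refine fS_segPt (a := n - 3) (t := (j + s) / 2) (by omega) ?_ (by linarith [hs.1])
    (by linarith [hs.2]) ?_ (by rwa [ha]) (by rwa [ha])
  · rw [hr, src_of_le (by omega), vcoord_zero, vcoord_low (by omega) le_rfl]
    simp [interpC]
    omega
  · rw [segOf, if_neg (by omega), if_neg (by omega), if_pos ha, hm, floor_add hs,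
      min_eq_right hj, add_sub_cancel_left]

theorem seg_sub_one {n j x y : ℕ} (hn : 3 ≤ n) (hj : j ≤ 2)
    (hx : imgCoord n (n - 1) j = vcoord n x) (hy : imgCoord n (n - 1) (j + 1) = vcoord n y) :
    Seg n (n - 1) x y (j / 3) ((j + 1) / 3) := fun s hs => by
  have hr : (j : ℝ) / 3 + ((j + 1) / 3 - j / 3) * s = (j + s) / 3 := by ring
  have hjn : (j : ℝ) ≤ 2 := by exact_mod_cast hj
  have hm : 6 * (((j : ℝ) + s) / 6) = j + s := by ring
  have hj0 : (0 : ℝ) ≤ j := j.cast_nonneg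
  have ha : n - 2 + 1 = n - 1 := by omega
  refine ⟨hr ▸ ⟨by linarith [hs.1], by linarith [hs.2]⟩, ?_⟩
  refine fS_segPt (a := n - 2) (t := (j + s) / 6) (by omega) ?_ (by linarith [hs.1])
    (by linarith [hs.2]) ?_ (by rwa [ha]) (by rwa [ha])
  · rw [hr, src_of_le (by omega), vcoord_zero, vcoord_sub_one hn]
    simp [interpC]
    ring
  · rw [segOf, if_neg (by omega), if_pos ha, if_pos (by linarith [hs.2]), hm, floor_add hs,
      min_eq_right hj, add_sub_cancel_left]

theorem seg_self {n j x y : ℕ} (hn : 3 ≤ n) (hj : j ≤ 2 * n - 2)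
    (hx : imgCoord n n j = vcoord n x) (hy : imgCoord n n (j + 1) = vcoord n y) :
    Seg n n x y (j / (2 * n - 1)) ((j + 1) / (2 * n - 1)) := fun s hs => by
  have hn' : (3 : ℝ) ≤ n := by exact_mod_cast hn
  have h0 : (0 : ℝ) < 2 * n - 1 := by linarith
  have h0' : (0 : ℝ) < 4 * n - 2 := by linarith
  have hr : (j : ℝ) / (2 * n - 1) + ((j + 1) / (2 * n - 1) - j / (2 * n - 1)) * s =
      (j + s) / (2 * n - 1) := by
    field_simp; ring
  have hjn : (j : ℝ) + 2 ≤ 2 * n := by exact_mod_cast (show j + 2 ≤ 2 * n by omega)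
  have hm : (4 * (n : ℝ) - 2) * ((j + s) / (4 * n - 2)) = j + s := mul_div_cancel₀ _ h0'.ne'
  have hj0 : (0 : ℝ) ≤ j := j.cast_nonneg
  have ht : ((j : ℝ) + s) / (4 * n - 2) ≤ 1 / 2 := by
    rw [div_le_div_iff₀ h0' two_pos]; linarith [hs.2]
  have ha : n - 1 + 1 = n := by omega
  refine ⟨hr ▸ ⟨by have := hs.1; positivity, (div_lt_one h0).2 (by linarith [hs.2])⟩, ?_⟩
  refine fS_segPt (a := n - 1) (t := (j + s) / (4 * n - 2)) (by omega) ?_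
    (by have := hs.1; positivity) (by linarith) ?_ (by rwa [ha]) (by rwa [ha])
  · rw [hr, src_of_le (by omega), vcoord_zero, vcoord_self hn]
    have : (4 * (n : ℝ) - 2) = 2 * (2 * n - 1) := by ring
    simp [interpC, this]
    field_simp
  · rw [segOf, if_pos ha, if_pos ht, hm, floor_add hs, min_eq_right hj, add_sub_cancel_left]

theorem seg_outer {n e : ℕ} (hn : 3 ≤ n) (he : n < e) (hen : e ≤ n + 2) :
    Seg n e n (n + 2) 0 1 := fun s hs => by
  have hr : 0 + (1 - 0) * s = s := by ring
  have hs1 := hs.1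
  have h2 : 2 * ((1 + s) / 2) - 1 = s := by ring
  rw [hr]
  refine ⟨hs, ?_⟩
  obtain rfl | rfl : e = n + 1 ∨ e = n + 2 := by omega
  · have hsrc : src n (n + 1) = n - 1 := if_pos rfl
    have ha : n - 2 + 1 = n - 1 := by omega
    refine fS_segPt (a := n - 2) (t := (1 + s) / 2) (j := 3) (by omega) ?_ (by linarith)
      (by linarith [hs.2]) ?_ ?_ ?_
    · rw [hsrc, vcoord_sub_one hn, vcoord_add_one hn]
      simp [interpC]
      ring
    · rw [segOf, if_neg (by omega), if_pos ha, if_neg (by linarith), h2]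
    · rw [imgCoord, if_neg (by omega), if_pos ha]; rfl
    · rw [imgCoord, if_neg (by omega), if_pos ha]; rfl
  · have hsrc : src n (n + 2) = n := by simp [src]
    have ha : n - 1 + 1 = n := by omega
    refine fS_segPt (a := n - 1) (t := (1 + s) / 2) (j := 2 * n - 1) (by omega) ?_ (by linarith)
      (by linarith [hs.2]) ?_ ?_ ?_
    · rw [hsrc, vcoord_self hn, vcoord_add_two hn]
      simp [interpC]
      ring
    · rw [segOf, if_pos ha, if_neg (by linarith), h2]
    · rw [imgCoord, if_pos ha, if_neg (by omega), if_neg (by omega), if_pos rfl]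
    · rw [imgCoord, if_pos ha, if_neg (by omega), if_neg (by omega), if_neg (by omega)]

theorem path_of_getElem {V : Type} {Q : ℕ → V → V → Prop} : ∀ {L : List ℕ} {p : ℕ → V},
    (∀ i, ∀ h : i < L.length, Twin Q L[i] (p i) (p (i + 1))) → Path Q L (p 0) (p L.length)
  | [], _, _ => rfl
  | x :: L, p, h => ⟨p 1, h 0 (by simp), path_of_getElem (L := L) (p := fun i => p (i + 1))
      fun i hi => h (i + 1) (by simpa using hi)⟩

theorem der_of_seg {V : Type} {Q : ℕ → V → V → Prop} {n e : ℕ} {g : ℝ → V} (hn : 3 ≤ n)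
    (he : 1 ≤ e) (hen : e ≤ n + 2)
    (h : ∀ e' c d, 1 ≤ e' → e' ≤ n + 2 → Seg n e (src n e') e' c d → Q e' (g c) (g d)) :
    Der n Q e (g 0) (g 1) := by
  refine ⟨he, hen, ?_⟩
  by_cases h1 : n < e
  · rw [if_pos h1]
    refine h _ 0 1 (by omega) le_rfl ?_
    rw [show src n (n + 2) = n by simp [src]]
    exact seg_outer hn h1 hen
  rw [if_neg h1]
  by_cases h2 : e = n - 2
  · subst h2
    rw [if_pos rfl]
    refine ⟨g (1 / 2), h _ _ _ (by omega) (by omega) ?_, h _ _ _ (by omega) (by omega) ?_⟩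
    · rw [src_of_le (by omega)]
      have := seg_sub_two hn (j := 0) (x := 0) (y := n - 1) (by omega)
        (by rw [imgCoord, if_neg (by omega), if_neg (by omega), if_pos rfl]; rfl)
        (by rw [imgCoord, if_neg (by omega), if_neg (by omega), if_pos rfl]; rfl)
      simpa using this
    · rw [show src n (n + 1) = n - 1 by simp [src]]
      have := seg_sub_two hn (j := 1) (x := n - 1) (y := n + 1) (by omega)
        (by rw [imgCoord, if_neg (by omega), if_neg (by omega), if_pos rfl]; rfl)
        (by rw [imgCoord, if_neg (by omega), if_neg (by omega), if_pos rfl]; rfl)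
      norm_num at this
      exact this
  rw [if_neg h2]
  suffices H : ∃ D : ℝ, D ≠ 0 ∧ (if e < n - 2 then
        (2 * (word n e).length + 4 : ℕ) = D ∧ imgCoord n e (2 * (word n e).length + 4) =
          vcoord n (n + 2) else (2 * (word n e).length + 3 : ℕ) = D) ∧
      (∀ j x y, j < 2 * (word n e).length + (if e < n - 2 then 4 else 3) →
        imgCoord n e j = vcoord n x → imgCoord n e (j + 1) = vcoord n y →
        Seg n e x y (j / D) ((j + 1) / D)) ∧
      imgCoord n e 1 = vcoord n (n - 1) ∧
      (∀ i, i ≤ (word n e).length → imgCoord n e (2 * i + 2) = vcoord n 0) ∧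
      (∀ i, ∀ hi : i < (word n e).length,
        imgCoord n e (2 * i + 3) = vcoord n (word n e)[i]) ∧
      imgCoord n e (2 * (word n e).length + 3) = vcoord n n by
    obtain ⟨D, hD, hend, hseg, i1, i2, i3, i4⟩ := H
    have i0 : imgCoord n e 0 = vcoord n 0 := by
      simp [imgCoord]
    have fwd : ∀ j x, 1 ≤ x → x ≤ n → j < 2 * (word n e).length + 3 →
        imgCoord n e j = vcoord n 0 → imgCoord n e (j + 1) = vcoord n x →
        Q x (g ((j : ℕ) / D)) (g ((j + 1 : ℕ) / D)) := fun j x hx hxn hj a b => by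
      refine h _ _ _ hx (by omega) ?_
      rw [src_of_le hxn]
      push_cast
      exact hseg j 0 x (by split_ifs <;> omega) a b
    have bwd : ∀ j x, 1 ≤ x → x ≤ n → j < 2 * (word n e).length + 3 →
        imgCoord n e j = vcoord n x → imgCoord n e (j + 1) = vcoord n 0 →
        Q x (g ((j + 1 : ℕ) / D)) (g ((j : ℕ) / D)) := fun j x hx hxn hj a b => by
      refine h _ _ _ hx (by omega) (Seg.rev hn hx ?_)
      rw [src_of_le hxn]
      push_cast
      exact hseg j x 0 (by split_ifs <;> omega) a b
    refine ⟨g ((2 : ℕ) / D), g ((2 * (word n e).length + 2 : ℕ) / D),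
      g ((2 * (word n e).length + 3 : ℕ) / D), ⟨g ((1 : ℕ) / D), ?_, ?_⟩, ?_, ?_, ?_⟩
    · have := fwd 0 (n - 1) (by omega) (by omega) (by omega) i0 i1
      simpa using this
    · exact bwd 1 (n - 1) (by omega) (by omega) (by omega) i1 (i2 0 (by omega))
    · refine path_of_getElem (p := fun i => g ((2 * i + 2 : ℕ) / D)) fun i hi => ?_
      have hx := mem_word hn (List.getElem_mem hi)
      exact ⟨g ((2 * i + 3 : ℕ) / D),
        fwd _ _ (by omega) (by omega) (by omega) (i2 i hi.le) (i3 i hi),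
        bwd (2 * i + 3) _ (by omega) (by omega) (by omega) (i3 i hi) (i2 (i + 1) hi)⟩
    · exact fwd _ _ (by omega) (by omega) (by omega) (i2 _ le_rfl) i4
    · split_ifs with hlt
      · rw [if_pos hlt] at hend
        have hlast := hseg (2 * (word n e).length + 3) n (n + 2) (by rw [if_pos hlt]; omega)
          i4 hend.2
        refine (?_ : (2 * (word n e).length + 4 : ℕ) / D = 1) ▸ h _ _ _ (by omega) le_rfl ?_
        · rw [hend.1, div_self hD]
        · rw [show src n (n + 2) = n by simp [src]]
          convert hlast using 2
          push_cast
          ring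
      · rw [if_neg hlt] at hend
        rw [hend, div_self hD]
  rcases lt_or_ge e (n - 2) with hlt | hge
  · have hw := word_eq (n := n) (e := e) (by omega)
    rw [if_neg (by omega)] at hw
    have hl : (word n e).length = n - 2 := by rw [hw]; simp
    have key : ∀ j, imgCoord n e j = if j = 0 then vcoord n 0 else if j ≤ 2 * n - 1 then
       (if j = 1 then vcoord n (n - 1)
        else if j = 2 * n - 1 then vcoord n n
        else if (j - 1) % 2 = 1 then vcoord n 0
        else vcoord n ((e + (j - 1) / 2 - 2) % (n - 2) + 1))
       else vcoord n (n + 2) := fun j => by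
      rw [imgCoord, if_neg (by omega), if_neg (by omega), if_neg (by omega)]
    have hD : (0 : ℝ) < 2 * n := by
      have : 0 < n := by omega
      positivity
    refine ⟨2 * n, hD.ne', ?_, ?_, ?_, ?_, ?_, ?_⟩
    · rw [if_pos hlt, key, hl, if_neg (by omega), if_neg (by omega)]
      refine ⟨?_, rfl⟩
      exact_mod_cast (show 2 * (n - 2) + 4 = 2 * n by omega)
    · intro j x y hj hx hy
      rw [if_pos hlt] at hj
      exact seg_low he (by omega) (by omega) hx hy
    · rw [key, if_neg one_ne_zero, if_pos (by omega), if_pos rfl]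
    · intro i hi
      rw [key, if_neg (by omega), if_pos (by omega), if_neg (by omega), if_neg (by omega),
        if_pos (by omega)]
    · intro i hi
      rw [key, if_neg (by omega), if_pos (by omega), if_neg (by omega), if_neg (by omega),
        if_neg (by omega)]
      simp only [hw, List.getElem_map, List.getElem_range]
      congr 3
      omega
    · rw [key, if_neg (by omega), if_pos (by omega), if_neg (by omega), if_pos (by omega)]
  obtain rfl | hne := eq_or_ne e n
  · have hw := word_eq (n := e) (e := e) (by omega)
    rw [if_pos rfl] at hw
    have hl : (word e e).length = e - 2 := by rw [hw]; simp
    have key : ∀ j, imgCoord e e j = if j = 0 then vcoord e 0 else if j ≤ 2 * e - 2 then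
       (if j = 1 then vcoord e (e - 1)
        else if j % 2 = 0 then vcoord e 0
        else if j = 3 then vcoord e (e - 2)
        else vcoord e ((j - 3) / 2))
       else if j = 2 * e - 1 then vcoord e e
       else vcoord e (e + 2) := fun j => by
      rw [imgCoord, if_pos rfl]
    have hD : (0 : ℝ) < 2 * e - 1 := by
      have : (3 : ℝ) ≤ e := by exact_mod_cast hn
      linarith
    refine ⟨2 * e - 1, hD.ne', ?_, ?_, ?_, ?_, ?_, ?_⟩
    · rw [if_neg (by omega), hl, eq_sub_iff_add_eq]
      exact_mod_cast (show 2 * (e - 2) + 3 + 1 = 2 * e by omega)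
    · intro j x y hj hx hy
      rw [if_neg (by omega)] at hj
      exact seg_self hn (by omega) hx hy
    · rw [key, if_neg one_ne_zero, if_pos (by omega), if_pos rfl]
    · intro i hi
      rw [key, if_neg (by omega), if_pos (by omega), if_neg (by omega), if_pos (by omega)]
    · intro i hi
      rw [key, if_neg (by omega), if_pos (by omega), if_neg (by omega), if_neg (by omega)]
      simp only [hw, List.getElem_map, List.getElem_range]
      split_ifs with h3
      · obtain rfl : i = 0 := by omega
        rw [zero_add, Nat.mod_eq_of_lt (by omega)]
        congr 1
        omega
      · rw [show i + (e - 3) = (i - 1) + (e - 2) by omega, Nat.add_mod_right,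
          Nat.mod_eq_of_lt (by omega)]
        congr 1
        omega
    · rw [key, if_neg (by omega), if_neg (by omega), if_pos (by omega)]
  · obtain rfl : e = n - 1 := by omega
    have hw : word n (n - 1) = [] := if_pos (.inl rfl)
    have key : ∀ j, imgCoord n (n - 1) j = if j = 0 then vcoord n 0
       else if j = 1 then vcoord n (n - 1)
       else if j = 2 then vcoord n 0
       else if j = 3 then vcoord n n
       else vcoord n (n + 2) := fun j => by
      rw [imgCoord, if_neg hne, if_pos rfl]
    refine ⟨3, three_ne_zero, ?_, ?_, ?_, ?_, ?_, ?_⟩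
    · rw [if_neg (by omega), hw]
      norm_num
    · intro j x y hj hx hy
      rw [if_neg (by omega), hw] at hj
      exact seg_sub_one hn (by simp at hj; omega) hx hy
    · exact key 1
    · intro i hi
      obtain rfl : i = 0 := by simpa [hw] using hi
      exact key 2
    · intro i hi
      simp [hw] at hi
    · rw [hw]
      exact key 3

/-! ### The edges of `X_0` -/

/-- Arm coordinates of `edgePt n e s`. -/
noncomputable def edgeCoord (n e : ℕ) (s : ℝ) : ℕ × ℝ :=
  if e ≤ n - 2 then (e - 1, s)
  else if e = n - 1 then (n - 2, s / 2)
  else if e = n then (n - 1, s / 2)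
  else if e = n + 1 then (n - 2, (1 + s) / 2)
  else (n - 1, (1 + s) / 2)

theorem edgePt_eq {n e : ℕ} (hn : 3 ≤ n) (he : 1 ≤ e) (hen : e ≤ n + 2) (s : ℝ) :
    edgePt n e s = ⟨embC n (edgeCoord n e s), Set.mem_range_self _⟩ := by
  refine Subtype.ext (congrArg (embC n) ?_)
  unfold edgeCoord
  split_ifs with h1 h2 h3 h4
  · rw [src_of_le (by omega), vcoord_zero, vcoord_low he h1]
    simp [interpC]
  · rw [src_of_le (by omega), vcoord_zero, h2, vcoord_sub_one hn]
    simp [interpC, div_eq_mul_inv]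
  · rw [src_of_le (by omega), vcoord_zero, h3, vcoord_self hn]
    simp [interpC, div_eq_mul_inv]
  · rw [h4, show src n (n + 1) = n - 1 from if_pos rfl, vcoord_sub_one hn, vcoord_add_one hn]
    simp [interpC]
    ring
  · obtain rfl : e = n + 2 := by omega
    rw [show src n (n + 2) = n by simp [src], vcoord_self hn, vcoord_add_two hn]
    simp [interpC]
    ring

theorem edgePt_inj {n e e' : ℕ} {s s' : ℝ} (hn : 3 ≤ n) (he : 1 ≤ e) (hen : e ≤ n + 2)
    (he' : 1 ≤ e') (hen' : e' ≤ n + 2) (hs : s ∈ Set.Ioo (0 : ℝ) 1)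
    (hs' : s' ∈ Set.Icc (0 : ℝ) 1) (h : edgePt n e s = edgePt n e' s') : e = e' ∧ s = s' := by
  obtain ⟨h0, h1⟩ := hs
  obtain ⟨h0', h1'⟩ := hs'
  rw [edgePt_eq hn he hen, edgePt_eq hn he' hen'] at h
  have key : ∀ e s, 1 ≤ e → e ≤ n + 2 → 0 ≤ s → s ≤ 1 → (edgeCoord n e s).1 < n ∧
      0 ≤ (edgeCoord n e s).2 ∧ (edgeCoord n e s).2 ≤ 1 := fun e s a b c d => by
    unfold edgeCoord
    split_ifs <;> refine ⟨?_, ?_, ?_⟩ <;> first | (dsimp only; omega) | (dsimp only; linarith)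
  obtain ⟨a1, a2, a3⟩ := key e s he hen h0.le h1.le
  obtain ⟨b1, b2, b3⟩ := key e' s' he' hen' h0' h1'
  have hpos : 0 < (edgeCoord n e s).2 := by
    unfold edgeCoord
    split_ifs <;> dsimp only <;> linarith
  obtain ⟨c1, c2⟩ := embC_inj (by omega) hpos (congrArg Subtype.val h).symm
  rw [Nat.mod_eq_of_lt a1, Nat.mod_eq_of_lt b1] at c1
  rw [max_eq_right a2, max_eq_right b2, min_eq_right a3, min_eq_right b3] at c2
  unfold edgeCoord at c1 c2
  split_ifs at c1 c2 <;> dsimp only at c1 c2 <;>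
    first
    | exact ⟨by omega, by linarith⟩
    | (exfalso; omega)
    | (exfalso; linarith)

theorem segPt_zero (n x y : ℕ) : segPt n x y 0 = vpt n x := by
  refine Subtype.ext ?_
  show embC n (interpC _ _ 0) = embC n (vcoord n x)
  by_cases h : (vcoord n x).2 = 0
  · simp [embC, interpC, h]
  · simp [interpC, h]

theorem edgePt_one {n e : ℕ} (hn : 3 ≤ n) (he : 1 ≤ e) : edgePt n e 1 = vpt n e := by
  rw [← segPt_zero n e (src n e), segPt_rev hn he, sub_zero]

theorem edgePt_ne_vpt {n e i : ℕ} {s : ℝ} (hn : 3 ≤ n) (he : 1 ≤ e) (hen : e ≤ n + 2)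
    (hs : s ∈ Set.Ioo (0 : ℝ) 1) (hi : i < n + 3) : edgePt n e s ≠ vpt n i := fun h => by
  rcases Nat.eq_zero_or_pos i with rfl | hi0
  · have h' : edgePt n e s = edgePt n 1 0 := by
      rw [h, edgePt, segPt_zero, src_of_le (by omega)]
    exact hs.1.ne' (edgePt_inj hn he hen le_rfl (by omega) hs (by simp) h').2
  · rw [← edgePt_one hn hi0] at h
    exact hs.2.ne (edgePt_inj hn he hen hi0 (by omega) hs (by simp) h).2

theorem vpt_inj {n i j : ℕ} (hn : 3 ≤ n) (hi : i < n + 3) (hj : j < n + 3)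
    (h : vpt n i = vpt n j) : i = j := by
  wlog hij : i < j generalizing i j
  · rcases eq_or_lt_of_not_gt hij with h' | h'
    · exact h'.symm
    · exact (this hj hi h.symm h').symm
  exfalso
  have hjpos : 0 < (vcoord n j).2 := by
    unfold vcoord
    split_ifs <;> first | omega | norm_num
  obtain ⟨c1, c2⟩ := embC_inj (by omega) hjpos (congrArg Subtype.val h)
  have key : ∀ i, i < n + 3 → (vcoord n i).1 < n ∧
      0 ≤ (vcoord n i).2 ∧ (vcoord n i).2 ≤ 1 := fun i hi => by
    unfold vcoord
    split_ifs <;> refine ⟨?_, ?_, ?_⟩ <;> first | (dsimp only; omega) | norm_num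
  obtain ⟨a1, a2, a3⟩ := key i hi
  obtain ⟨b1, b2, b3⟩ := key j hj
  rw [Nat.mod_eq_of_lt a1, Nat.mod_eq_of_lt b1] at c1
  rw [max_eq_right a2, max_eq_right b2, min_eq_right a3, min_eq_right b3] at c2
  unfold vcoord at c1 c2
  split_ifs at c1 c2 <;> dsimp only at c1 c2 <;>
    first
    | omega
    | (norm_num at c2)

theorem mem_verts_X0graph {n : ℕ} {z : Sspace n} :
    z ∈ (X0graph n).verts ↔ ∃ i < n + 3, vpt n i = z := by
  classical
  simp [X0graph]

theorem edge_X0graph {n : ℕ} (hn : 3 ≤ n) (E : Fin (X0graph n).nE) :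
    ∃ e, 1 ≤ e ∧ e ≤ n + 2 ∧ ∀ s, (X0graph n).edge E s = edgePt n e s := by
  have hE : (E : ℕ) < n + 2 := E.isLt
  have h : ∀ e, 1 ≤ e → e ≤ n + 2 → (∀ s, X0edgeCoord n E s = edgeCoord n e s) →
      ∃ e, 1 ≤ e ∧ e ≤ n + 2 ∧ ∀ s, (X0graph n).edge E s = edgePt n e s := fun e a b c =>
    ⟨e, a, b, fun s => by
      rw [edgePt_eq hn a b]
      exact Subtype.ext (congrArg (embC n) (c s))⟩
  unfold X0edgeCoord at h
  by_cases h1 : (E : ℕ) < n - 2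
  · exact h (E + 1) (by omega) (by omega) fun s => by
      rw [if_pos h1, edgeCoord, if_pos (by omega), Nat.add_sub_cancel]
  by_cases h2 : (E : ℕ) = n - 2
  · exact h (n - 1) (by omega) (by omega) fun s => by
      rw [if_neg h1, if_pos h2, edgeCoord, if_neg (by omega), if_pos rfl]
  by_cases h3 : (E : ℕ) = n - 1
  · exact h (n + 1) (by omega) (by omega) fun s => by
      rw [if_neg h1, if_neg h2, if_pos h3, edgeCoord, if_neg (by omega), if_neg (by omega),
        if_neg (by omega), if_pos rfl]
  by_cases h4 : (E : ℕ) = n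
  · exact h n (by omega) (by omega) fun s => by
      rw [if_neg h1, if_neg h2, if_neg h3, if_pos h4, edgeCoord, if_neg (by omega),
        if_neg (by omega), if_pos rfl]
  · exact h (n + 2) (by omega) le_rfl fun s => by
      rw [if_neg h1, if_neg h2, if_neg h3, if_neg h4, edgeCoord, if_neg (by omega),
        if_neg (by omega), if_neg (by omega), if_neg (by omega)]

theorem continuous_edgePt (n e : ℕ) : Continuous (edgePt n e) := by
  refine Continuous.subtype_mk (f := fun s => embC n _) ?_ _
  unfold embC interpC
  dsimp only
  fun_prop

/-! ### The simple-od structure on `T` -/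

section

variable {n n' : ℕ} {T : Type} {Δ : GraphData T} {s₀ : T}
  {k : Fin n' → ℕ} {t : Fin n' → ℕ → T} {α : Sspace n → T} {β : T → Sspace n}

/-- `x` and `y` are adjacent in `Δ` and mapped by `β` to the endpoints of the `e`-th edge of
`X_0`. -/
def EdgeOver (Δ : GraphData T) (β : T → Sspace n) (e : ℕ) (x y : T) : Prop :=
  1 ≤ e ∧ e ≤ n + 2 ∧ Δ.Adj x y ∧ β x = vpt n (src n e) ∧ β y = vpt n e

open Classical in
/-- The index of the vertex of `X_0` to which `β` maps `v`. -/
noncomputable def typOver (β : T → Sspace n) (v : T) : ℕ :=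
  if h : ∃ i, i < n + 3 ∧ β v = vpt n i then h.choose else 0

open Classical in
/-- The index of the arm containing the vertex `v`. -/
noncomputable def armOf (k : Fin n' → ℕ) (t : Fin n' → ℕ → T) (v : T) : ℕ :=
  if h : ∃ i : Fin n', ∃ j, 1 ≤ j ∧ j ≤ k i ∧ v = t i j then h.choose else 0

theorem typOver_eq {v : T} {i : ℕ} (hn : 3 ≤ n) (hi : i < n + 3) (h : β v = vpt n i) :
    typOver β v = i := by
  have hex : ∃ i, i < n + 3 ∧ β v = vpt n i := ⟨i, hi, h⟩
  rw [typOver, dif_pos hex]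
  exact vpt_inj hn hex.choose_spec.1 hi (hex.choose_spec.2.symm.trans h)

theorem armOf_lt (h : n' ≤ n - 1) (hn : 3 ≤ n) (v : T) : armOf k t v < n - 1 := by
  unfold armOf
  split_ifs with hex
  · exact lt_of_lt_of_le hex.choose.isLt h
  · omega

variable [TopologicalSpace T]

theorem armOf_eq (hT : IsSimpleOdWith Δ n' s₀ k t) {i : Fin n'} {j : ℕ} (h1 : 1 ≤ j)
    (h2 : j ≤ k i) : armOf k t (t i j) = i := by
  have hex : ∃ i' : Fin n', ∃ j', 1 ≤ j' ∧ j' ≤ k i' ∧ t i j = t i' j' := ⟨i, j, h1, h2, rfl⟩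
  rw [armOf, dif_pos hex]
  obtain ⟨j', a, b, c⟩ := hex.choose_spec
  exact congrArg Fin.val (hT.2.2.2.2.1 _ _ _ _ h1 h2 a b c).1.symm

/-- The simple-od structure carried by a simple-`n'`-od graph over `X_0`. -/
noncomputable def odStrOver (hn : 3 ≤ n) (hn' : n' ≤ n - 1) (hT : IsSimpleOdWith Δ n' s₀ k t)
    (hβ₀ : β s₀ = vpt n 0) : OdStr n (EdgeOver Δ β) where
  typ := typOver β
  cen v := v = s₀
  par v w := ∃ i j, j + 1 ≤ k i ∧ v = t i (j + 1) ∧ w = t i j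
  arm := armOf k t
  edge := by
    rintro e x y ⟨h1, h2, h3, h4, h5⟩
    have hsrc : src n e < n + 3 := by unfold src; split_ifs <;> omega
    refine ⟨h1, h2, typOver_eq hn hsrc h4, typOver_eq hn (by omega) h5, ?_⟩
    obtain ⟨i, j, hj, h⟩ := (hT.2.2.2.2.2.2 x y).1 h3
    rcases Set.pair_eq_pair_iff.1 h with ⟨rfl, rfl⟩ | ⟨rfl, rfl⟩
    · exact .inr ⟨i, j, hj, rfl, rfl⟩
    · exact .inl ⟨i, j, hj, rfl, rfl⟩
  par_unique := by
    rintro v w w' ⟨i, j, h1, rfl, rfl⟩ ⟨i', j', h1', h2, rfl⟩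
    obtain ⟨rfl, h⟩ := hT.2.2.2.2.1 _ _ _ _ (by omega) h1 (by omega) h1' h2
    obtain rfl : j = j' := by omega
    rfl
  child_unique := by
    rintro v w v' ⟨i, j, h1, rfl, rfl⟩ ⟨i', j', h1', rfl, h2⟩ hc
    have hj : j ≠ 0 := by rintro rfl; exact hc (hT.2.2.1 i)
    have hj' : j' ≠ 0 := by rintro rfl; exact hc (h2.trans (hT.2.2.1 i'))
    obtain ⟨rfl, rfl⟩ := hT.2.2.2.2.1 _ _ _ _ (by omega) (by omega) (by omega) (by omega) h2
    rfl
  arm_inj := by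
    rintro w v v' rfl ⟨i, j, h1, rfl, h2⟩ ⟨i', j', h1', rfl, h2'⟩ h
    have hj : j = 0 := by
      by_contra hj
      exact hT.2.2.2.2.2.1 i j (by omega) (by omega) h2.symm
    have hj' : j' = 0 := by
      by_contra hj
      exact hT.2.2.2.2.2.1 i' j' (by omega) (by omega) h2'.symm
    rw [armOf_eq hT (by omega) h1, armOf_eq hT (by omega) h1'] at h
    rw [hj, hj', Fin.ext h]
  arm_par := by
    rintro v w ⟨i, j, h1, rfl, rfl⟩ hc
    have hj : j ≠ 0 := by rintro rfl; exact hc (hT.2.2.1 i)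
    rw [armOf_eq hT (by omega) h1, armOf_eq hT (by omega) (by omega)]
  cen_par := by
    rintro v w ⟨i, j, h1, rfl, rfl⟩ hc
    exact hT.2.2.2.2.2.1 i _ (by omega) h1 hc
  cen_typ := by
    rintro v rfl
    exact typOver_eq hn (by omega) hβ₀
  arm_lt := armOf_lt hn' hn

theorem edgeOver_of_path {δ : ℝ → T} {e : ℕ} (hn : 3 ≤ n) [T2Space T] (hΔ : Δ.IsGraph)
    (hβ : IsSimplicialMap Δ (X0graph n) β) (he : 1 ≤ e) (hen : e ≤ n + 2) (hδ : Continuous δ)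
    (h : ∀ s ∈ Set.Ioo (0 : ℝ) 1, β (δ s) = edgePt n e s) : EdgeOver Δ β e (δ 0) (δ 1) := by
  have avoid : ∀ s ∈ Set.Ioo (0 : ℝ) 1, δ s ∉ (Δ.verts : Set T) := fun s hs hv => by
    obtain ⟨i, hi, h'⟩ := mem_verts_X0graph.1 (hβ.2.1 _ hv)
    exact edgePt_ne_vpt hn he hen hs hi ((h s hs).symm.trans h'.symm)
  obtain ⟨hcont, -, -, -, -, -, hcov, hmeet, -⟩ := hΔ
  have hmid : (1 / 2 : ℝ) ∈ Set.Ioo (0 : ℝ) 1 := by norm_num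
  have hclosed : ∀ E, IsClosed (Δ.edge E '' Set.Icc 0 1) := fun E =>
    (isCompact_Icc.image_of_continuousOn (hcont E)).isClosed
  obtain ⟨E, hE⟩ := Set.mem_iUnion.1 (hcov.symm ▸ Set.mem_univ (δ (1 / 2)))
  have hsub : ∀ s ∈ Set.Ioo (0 : ℝ) 1, δ s ∈ Δ.edge E '' Set.Icc 0 1 := by
    by_contra! hne
    obtain ⟨s, hs, hsE⟩ := hne
    have hpre : IsPreconnected (δ '' Set.Ioo (0 : ℝ) 1) :=
      isPreconnected_Ioo.image _ hδ.continuousOn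
    have hB : IsClosed (⋃ E' : {E' // E' ≠ E}, Δ.edge E' '' Set.Icc 0 1) :=
      isClosed_iUnion_of_finite fun E' => hclosed E'
    have hcover : ∀ x, x ∉ Δ.edge E '' Set.Icc 0 1 →
        x ∈ ⋃ E' : {E' // E' ≠ E}, Δ.edge E' '' Set.Icc 0 1 := fun x hx => by
      obtain ⟨E', hE'⟩ := Set.mem_iUnion.1 (hcov.symm ▸ Set.mem_univ x)
      exact Set.mem_iUnion.2 ⟨⟨E', by rintro rfl; exact hx hE'⟩, hE'⟩
    obtain ⟨_, ⟨r, hr, rfl⟩, hA, hB⟩ := isPreconnected_closed_iff.1 hpre _ _ (hclosed E) hB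
      (fun x _ => or_iff_not_imp_left.2 (hcover x)) ⟨_, ⟨_, hmid, rfl⟩, hE⟩
      ⟨_, ⟨s, hs, rfl⟩, hcover _ hsE⟩
    obtain ⟨⟨E', hE'⟩, hB⟩ := Set.mem_iUnion.1 hB
    exact avoid r hr (hmeet _ _ hE'.symm ⟨hA, hB⟩)
  obtain ⟨ε, e', hε, hpair, hsub', he', hen', hβε⟩ : ∃ (ε : ℝ → T) (e' : ℕ),
      ContinuousOn ε (Set.Icc 0 1) ∧ ({Δ.edge E 0, Δ.edge E 1} : Set T) = {ε 0, ε 1} ∧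
      (∀ s ∈ Set.Ioo (0 : ℝ) 1, δ s ∈ ε '' Set.Icc 0 1) ∧ 1 ≤ e' ∧ e' ≤ n + 2 ∧
      ∀ r ∈ Set.Icc (0 : ℝ) 1, β (ε r) = edgePt n e' r := by
    rcases hβ.2.2 E with ⟨w, hw, hconst⟩ | ⟨E', hE' | hE'⟩
    · obtain ⟨r, hr, hδr⟩ := hsub _ hmid
      obtain ⟨i, hi, h'⟩ := mem_verts_X0graph.1 hw
      refine absurd ?_ (edgePt_ne_vpt hn he hen hmid hi)
      rw [← h _ hmid, ← hδr, hconst r hr, h']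
    · obtain ⟨e', a, b, c⟩ := edge_X0graph hn E'
      exact ⟨Δ.edge E, e', hcont E, rfl, hsub, a, b, fun r hr => (hE' r hr).trans (c r)⟩
    · obtain ⟨e', a, b, c⟩ := edge_X0graph hn E'
      have hmaps : ∀ r ∈ Set.Icc (0 : ℝ) 1, 1 - r ∈ Set.Icc (0 : ℝ) 1 := fun r hr =>
        ⟨by linarith [hr.2], by linarith [hr.1]⟩
      refine ⟨fun r => Δ.edge E (1 - r), e',
        (hcont E).comp (by fun_prop) hmaps, ?_, fun s hs => ?_, a, b, fun r hr => ?_⟩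
      · simp [Set.pair_comm]
      · obtain ⟨r, hr, hδr⟩ := hsub s hs
        exact ⟨1 - r, hmaps r hr, by simpa using hδr⟩
      · rw [hE' _ (hmaps r hr), sub_sub_cancel, c]
  have heq : ∀ s ∈ Set.Ioo (0 : ℝ) 1, e = e' ∧ ε s = δ s := fun s hs => by
    obtain ⟨r, hr, hδr⟩ := hsub' s hs
    obtain ⟨a, rfl⟩ := edgePt_inj hn he hen he' hen' hs hr
      (by rw [← h s hs, ← hδr, hβε r hr])
    exact ⟨a, hδr⟩
  obtain rfl := (heq _ hmid).1
  have hext : Set.EqOn ε δ (Set.Icc 0 1) := by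
    have hcl : Set.Icc (0 : ℝ) 1 = closure (Set.Ioo 0 1) := (closure_Ioo zero_ne_one).symm
    exact Set.EqOn.of_subset_closure (fun s hs => (heq s hs).2) hε hδ.continuousOn
      Set.Ioo_subset_Icc_self hcl.le
  have h0 : ε 0 = δ 0 := hext (by simp)
  have h1 : ε 1 = δ 1 := hext (by simp)
  refine ⟨he, hen, ⟨E, by rw [hpair, h0, h1]⟩, ?_, ?_⟩
  · rw [← h0, hβε 0 (by simp), edgePt, segPt_zero]
  · rw [← h1, hβε 1 (by simp), edgePt_one hn he]

theorem der_of_path [T2Space T] {M : ℕ} (hn : 3 ≤ n) (hΔ : Δ.IsGraph) (hα : Continuous α)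
    (hβ : IsSimplicialMap Δ (X0graph n) β) (hfac : β ∘ α = (fS n)^[M]) (m : ℕ) :
    ∀ {l e : ℕ} {γ : ℝ → Sspace n}, l + m = M → 1 ≤ e → e ≤ n + 2 → Continuous γ →
      (∀ s ∈ Set.Ioo (0 : ℝ) 1, (fS n)^[l] (γ s) = edgePt n e s) →
      (Der n)^[m] (EdgeOver Δ β) e (α (γ 0)) (α (γ 1)) := by
  induction m with
  | zero =>
    intro l e γ hl he hen hγ h
    refine edgeOver_of_path (δ := fun s => α (γ s)) hn hΔ hβ he hen (hα.comp hγ) fun s hs => ?_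
    rw [← h s hs, show l = M from hl, ← hfac]
    rfl
  | succ m ih =>
    intro l e γ hl he hen hγ h
    rw [Function.iterate_succ_apply']
    refine der_of_seg (g := fun s => α (γ s)) hn he hen fun e' c d he' hen' hseg => ?_
    have := ih (l := l + 1) (γ := fun s => γ (c + (d - c) * s)) (by omega) he' hen'
      (hγ.comp (by fun_prop)) fun s hs => ?_
    · simpa using this
    · rw [Function.iterate_succ_apply', h _ (hseg s hs).1, (hseg s hs).2, edgePt]

end

end SimpleOd

/-- Let `n ≥ 3`, `m ≥ 2`, let `X_m` be the subdivision of `S` with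
vertex set `f^{-m}(V(X_0))` and `Φ_0^m = f^m`.  Given a simple-`n'`-od graph `T`
(`1 ≤ n' ≤ n - 1`) with branch point `s₀` and simplicial maps `α : X_m → T`
(surjective) and `β : T → X_0` with `β ∘ α = Φ_0^m`, `β s₀ = v_0`, there are
`1 ≤ n'₁ ≤ n'`, a simple-`n'₁`-od graph `T̂` with branch point `ŝ₀` and arms
`⟨ŝ₀, ŝ i 1, …, ŝ i (k i)⟩`, and simplicial maps `α̂ : X_m → T̂`, `β̂ : T̂ → X_0`
with `β̂ ∘ α̂ = Φ_0^m`, `β̂ ŝ₀ = v_0` and `β̂ (ŝ i 1) = v_{n-1}` for every arm `i`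
(so `β̂` maps every edge of `T̂` at the branch point onto `⟨v_0, v_{n-1}⟩`). -/
theorem statement15 (n : ℕ) (hn : 3 ≤ n) (m : ℕ) (hm : 2 ≤ m)
    (Γm : GraphData (Sspace n)) (hΓm : Γm.IsGraph)
    (hverts : (Γm.verts : Set (Sspace n)) = (fS n)^[m] ⁻¹' ((X0graph n).verts : Set (Sspace n)))
    (n' : ℕ) (h1 : 1 ≤ n') (h2 : n' ≤ n - 1)
    (T : Type) [MetricSpace T] (Δ : GraphData T) (s₀ : T)
    (hT : IsSimpleOdGraphData Δ n' s₀)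
    (α : Sspace n → T) (β : T → Sspace n)
    (hα : IsSimplicialMap Γm Δ α) (hαsurj : Function.Surjective α)
    (hβ : IsSimplicialMap Δ (X0graph n) β)
    (hfac : β ∘ α = (fS n)^[m]) (hβ₀ : β s₀ = vpt n 0) :
    ∃ n'₁ : ℕ, 1 ≤ n'₁ ∧ n'₁ ≤ n' ∧
      ∃ (T' : Type) (_ : MetricSpace T') (Δ' : GraphData T') (s₀' : T')
        (k : Fin n'₁ → ℕ) (s : Fin n'₁ → ℕ → T'),
        IsSimpleOdWith Δ' n'₁ s₀' k s ∧
        ∃ (α' : Sspace n → T') (β' : T' → Sspace n),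
          IsSimplicialMap Γm Δ' α' ∧ IsSimplicialMap Δ' (X0graph n) β' ∧
          β' ∘ α' = (fS n)^[m] ∧ β' s₀' = vpt n 0 ∧
          ∀ i : Fin n'₁, β' (s i 1) = vpt n (n - 1) := by
  obtain ⟨k, t, hod⟩ := hT
  have hΔ := hod.1
  exfalso
  refine SimpleOd.not_iterate_der hn m (SimpleOd.odStrOver hn h2 hod hβ₀) (α (vpt n 0))
    fun e he hen => ⟨α (SimpleOd.edgePt n e 1), ?_⟩
  have h := SimpleOd.der_of_path hn hΔ hα.1 hβ hfac m (zero_add m) he (by omega)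
    (SimpleOd.continuous_edgePt n e) fun _ _ => rfl
  have h0 : SimpleOd.edgePt n e 0 = vpt n 0 := by
    rw [SimpleOd.edgePt, SimpleOd.segPt_zero, SimpleOd.src_of_le hen]
  rwa [h0] at h
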